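/- Let k ≥ 2 be a fixed integer and let δ > 0 be given. Then the number of quadruples of integers (n₁, n₂, n₃, n₄) with N < n₁, n₂, n₃, n₄ ≤ 2N and |n₁^{1/k} + n₂^{1/k} − n₃^{1/k} − n₄^{1/k}| < δ N^{1/k} is, for every ε > 0, ≪_ε N^ε (N⁴ δ + N²). -/

import Mathlib

open Real

lemma rs_rpow_lip (a b β : ℝ) (ha : 0 < a) : ∃ L : ℝ, 0 ≤ L ∧ ∀ x y : ℝ, a ≤ x → x ≤ b → a ≤ y → y ≤ b →
    |x ^ β - y ^ β| ≤ L * |x - y| := by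
  have hc : ContinuousOn (fun x : ℝ => β * x ^ (β - 1)) (Set.Icc a b) := by
    apply ContinuousOn.mul continuousOn_const
    apply ContinuousOn.rpow_const continuousOn_id
    intro x hx; left; simp only [id]; linarith [hx.1]
  obtain ⟨L, hL⟩ := isCompact_Icc.exists_bound_of_continuousOn hc
  refine ⟨max L 0, le_max_right _ _, fun x y hx hx' hy hy' => ?_⟩
  have := (convex_Icc a b).norm_image_sub_le_of_norm_hasDerivWithin_le (f := fun x : ℝ => x ^ β)
    (f' := fun x : ℝ => β * x ^ (β - 1)) (C := max L 0) (x := y) (y := x)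
    (fun z hz => (Real.hasDerivAt_rpow_const (Or.inl (by linarith [hz.1]))).hasDerivWithinAt)
    (fun z hz => (hL z hz).trans (le_max_left _ _)) ⟨hy, hy'⟩ ⟨hx, hx'⟩
  simpa [Real.norm_eq_abs] using this

lemma rs_taylor (a b α : ℝ) (ha : 0 < a) (ha1 : a ≤ 1) (hb : 1 ≤ b) : ∃ L : ℝ, 0 ≤ L ∧ ∀ y : ℝ, a ≤ y → y ≤ b →
    |y ^ α - 1 - α * (y - 1)| ≤ L * (y - 1) ^ 2 := by
  obtain ⟨L, hL0, hL⟩ := rs_rpow_lip a b (α - 1) ha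
  refine ⟨|α| * L, by positivity, fun y hy hy' => ?_⟩
  have hsub : ∀ z ∈ Set.uIcc 1 y, a ≤ z ∧ z ≤ b ∧ |z - 1| ≤ |y - 1| := by
    intro z hz
    rcases Set.mem_uIcc.1 hz with h | h
    · refine ⟨by linarith, by linarith, ?_⟩
      rw [abs_of_nonneg (by linarith), abs_of_nonneg (by linarith)]; linarith
    · refine ⟨by linarith, by linarith, ?_⟩
      rw [abs_of_nonpos (by linarith), abs_of_nonpos (by linarith)]; linarith
  have := (convex_uIcc 1 y).norm_image_sub_le_of_norm_hasDerivWithin_le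
    (f := fun x : ℝ => x ^ α - α * x)
    (f' := fun x : ℝ => α * x ^ (α - 1) - α * 1) (C := |α| * L * |y - 1|) (x := 1) (y := y)
    (fun z hz => ((Real.hasDerivAt_rpow_const (Or.inl (by linarith [(hsub z hz).1]))).sub
      ((hasDerivAt_id z).const_mul α)).hasDerivWithinAt)
    (fun z hz => by
      obtain ⟨h1, h2, h3⟩ := hsub z hz
      have := hL z 1 h1 h2 ha1 hb
      rw [Real.one_rpow] at this
      rw [Real.norm_eq_abs, ← mul_sub, abs_mul, mul_assoc]
      apply mul_le_mul_of_nonneg_left _ (abs_nonneg _)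
      exact this.trans (mul_le_mul_of_nonneg_left h3 hL0)) Set.left_mem_uIcc Set.right_mem_uIcc
  simp only [Real.norm_eq_abs, Real.one_rpow] at this
  calc _ = |y ^ α - α * y - (1 - α * 1)| := by congr 1; ring
    _ ≤ _ := this
    _ = _ := by rw [mul_assoc, ← sq, sq_abs]

/-- Scaled second order expansion. -/
lemma rs_taylor2 (α : ℝ) (D : ℝ) (hD : 1 ≤ D) : ∃ L : ℝ, 0 ≤ L ∧ ∀ l x v : ℝ, 0 < l → D⁻¹ ≤ x → x ≤ D →
    D⁻¹ * (l * x) ≤ v → v ≤ D * (l * x) →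
    |v ^ α - l ^ α * x ^ α - α * l ^ (α - 1) * x ^ (α - 1) * (v - l * x)| ≤ L * l ^ (α - 2) * (v - l * x) ^ 2 := by
  have hD0 : 0 < D := by linarith
  obtain ⟨L, hL0, hL⟩ := rs_taylor D⁻¹ D α (by positivity) (inv_le_one_of_one_le₀ hD) hD
  have hc : ContinuousOn (fun x : ℝ => x ^ (α - 2)) (Set.Icc D⁻¹ D) := by
    apply ContinuousOn.rpow_const continuousOn_id
    intro x hx; left; simp only [id]; have := hx.1; have : 0 < D⁻¹ := by positivity
    linarith
  obtain ⟨M, hM⟩ := isCompact_Icc.exists_bound_of_continuousOn hc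
  refine ⟨L * max M 0, by positivity, fun l x v hl hx hx' hv hv' => ?_⟩
  have hx0 : 0 < x := lt_of_lt_of_le (by positivity) hx
  have hlx : 0 < l * x := by positivity
  have h1 := hL (v / (l * x)) (by rwa [le_div_iff₀ hlx]) (by rwa [div_le_iff₀ hlx])
  have hv0 : 0 < v := lt_of_lt_of_le (by positivity) hv
  rw [Real.div_rpow hv0.le hlx.le] at h1
  have hp : 0 < (l * x) ^ α := by positivity
  have h2 := mul_le_mul_of_nonneg_left h1 hp.le
  rw [← abs_of_pos hp, ← abs_mul, abs_of_pos hp] at h2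
  have e1 : (l * x) ^ α * (v ^ α / (l * x) ^ α - 1 - α * (v / (l * x) - 1)) =
      v ^ α - l ^ α * x ^ α - α * l ^ (α - 1) * x ^ (α - 1) * (v - l * x) := by
    have e2 : l ^ (α - 1) = l ^ α / l := Real.rpow_sub_one hl.ne' _
    have e3 : x ^ (α - 1) = x ^ α / x := Real.rpow_sub_one hx0.ne' _
    rw [e2, e3, Real.mul_rpow hl.le hx0.le]
    have := (Real.rpow_pos_of_pos hl α).ne'
    have := (Real.rpow_pos_of_pos hx0 α).ne'
    field_simp
  rw [e1] at h2
  refine h2.trans ?_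
  have e4 : (l * x) ^ α * (L * (v / (l * x) - 1) ^ 2) = L * (x ^ (α - 2)) * l ^ (α - 2) * (v - l * x) ^ 2 := by
    have e2 : l ^ (α - 2) = l ^ α / l ^ 2 := by rw [Real.rpow_sub hl]; norm_num
    have e3 : x ^ (α - 2) = x ^ α / x ^ 2 := by rw [Real.rpow_sub hx0]; norm_num
    rw [e2, e3, Real.mul_rpow hl.le hx0.le]
    field_simp
  rw [e4]
  have h5 := hM x ⟨hx, hx'⟩
  rw [Real.norm_eq_abs] at h5
  have h6 : x ^ (α - 2) ≤ max M 0 := (le_abs_self _).trans (h5.trans (le_max_left _ _))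
  gcongr

noncomputable def rsG (α : ℝ) (x : Fin 4 → ℝ) : ℝ := x 0 ^ α + x 1 ^ α - x 2 ^ α - x 3 ^ α

noncomputable def rsL (α : ℝ) (x y : Fin 4 → ℝ) : ℝ :=
  x 0 ^ (α - 1) * y 0 + x 1 ^ (α - 1) * y 1 - x 2 ^ (α - 1) * y 2 - x 3 ^ (α - 1) * y 3

def rsB (α : ℝ) (x : Fin 4 → ℝ) (N t : ℝ) (y : Fin 4 → ℝ) : Prop :=
  |y 3| ≤ t * N ∧ (∀ i, |y i - y 3 * x i| ≤ t) ∧ |rsL α x y| ≤ t / N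

def rsDir (D : ℝ) (x : Fin 4 → ℝ) : Prop := x 3 = 1 ∧ ∀ i, D⁻¹ ≤ x i ∧ x i ≤ D

def rsC (v : Fin 4 → ℤ) : Fin 4 → ℝ := fun i => (v i : ℝ)

def rsS (α : ℝ) (D : ℕ) : Set (Fin 4 → ℤ) :=
  {v | 0 < v 3 ∧ (∀ i, v 3 ≤ D * v i ∧ v i ≤ D * v 3) ∧ |rsG α (rsC v)| ≤ (v 3 : ℝ) ^ (α - 2)}

noncomputable def rsX (v : Fin 4 → ℤ) : Fin 4 → ℝ := fun i => (v i : ℝ) / (v 3 : ℝ)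

lemma rs_self (α : ℝ) (x : Fin 4 → ℝ) (hx : ∀ i, 0 < x i) : rsL α x x = rsG α x := by
  unfold rsL rsG
  have : ∀ i, x i ^ (α - 1) * x i = x i ^ α := fun i => by
    rw [Real.rpow_sub_one (hx i).ne']; have := (hx i).ne'; field_simp
  simp only [this]

lemma rs_expand (α : ℝ) (D : ℝ) (hD : 1 ≤ D) : ∃ L : ℝ, 0 ≤ L ∧ ∀ (l t : ℝ) (x v : Fin 4 → ℝ), 0 < l →
    rsDir D x → (∀ i, D⁻¹ * (l * x i) ≤ v i ∧ v i ≤ D * (l * x i)) → (∀ i, |v i - l * x i| ≤ t) →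
    |rsG α v - l ^ α * rsG α x - α * l ^ (α - 1) * (rsL α x v - l * rsG α x)| ≤ L * l ^ (α - 2) * t ^ 2 := by
  obtain ⟨L, hL0, hL⟩ := rs_taylor2 α D hD
  refine ⟨4 * L, by positivity, fun l t x v hl hx hv ht => ?_⟩
  have hx0 : ∀ i, 0 < x i := fun i => lt_of_lt_of_le (by positivity) (hx.2 i).1
  have key : ∀ i, |v i ^ α - l ^ α * x i ^ α - α * l ^ (α - 1) * x i ^ (α - 1) * (v i - l * x i)|
      ≤ L * l ^ (α - 2) * t ^ 2 := fun i => by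
    refine (hL l (x i) (v i) hl (hx.2 i).1 (hx.2 i).2 (hv i).1 (hv i).2).trans ?_
    have : (v i - l * x i) ^ 2 ≤ t ^ 2 := sq_le_sq' (by linarith [(abs_le.1 (ht i)).1]) (abs_le.1 (ht i)).2
    gcongr
  rw [← rs_self α x hx0]
  have hs := rs_self α x hx0
  have e : rsG α v - l ^ α * rsL α x x - α * l ^ (α - 1) * (rsL α x v - l * rsL α x x) =
     (v 0 ^ α - l ^ α * x 0 ^ α - α * l ^ (α - 1) * x 0 ^ (α - 1) * (v 0 - l * x 0))
     + (v 1 ^ α - l ^ α * x 1 ^ α - α * l ^ (α - 1) * x 1 ^ (α - 1) * (v 1 - l * x 1))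
     - (v 2 ^ α - l ^ α * x 2 ^ α - α * l ^ (α - 1) * x 2 ^ (α - 1) * (v 2 - l * x 2))
     - (v 3 ^ α - l ^ α * x 3 ^ α - α * l ^ (α - 1) * x 3 ^ (α - 1) * (v 3 - l * x 3)) := by
    nth_rw 1 [hs]
    unfold rsL rsG; ring
  rw [e]
  have h0 := abs_le.1 (key 0)
  have h1 := abs_le.1 (key 1)
  have h2 := abs_le.1 (key 2)
  have h3 := abs_le.1 (key 3)
  rw [abs_le]; constructor <;> linarith [h0.1, h0.2, h1.1, h1.2, h2.1, h2.2, h3.1, h3.2]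

lemma rs_dir {α : ℝ} {D : ℕ} (hD : 1 ≤ D) {q : Fin 4 → ℤ} (hq : q ∈ rsS α D) : rsDir D (rsX q) := by
  obtain ⟨h3, hi, -⟩ := hq
  have h3' : (0 : ℝ) < q 3 := by exact_mod_cast h3
  have hD' : (0 : ℝ) < D := by exact_mod_cast hD
  refine ⟨by simp [rsX, h3'.ne'], fun i => ?_⟩
  obtain ⟨h1, h2⟩ := hi i
  have h1' : (q 3 : ℝ) ≤ D * q i := by exact_mod_cast h1
  have h2' : (q i : ℝ) ≤ D * q 3 := by exact_mod_cast h2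
  unfold rsX
  rw [le_div_iff₀ h3', div_le_iff₀ h3', inv_mul_le_iff₀ hD']
  exact ⟨h1', h2'⟩

lemma rs_GX {α : ℝ} {D : ℕ} (hD : 1 ≤ D) {q : Fin 4 → ℤ} (hq : q ∈ rsS α D) {N : ℝ} (hN : 0 < N)
    (hNq : N ≤ q 3) : |rsG α (rsX q)| ≤ 1 / N ^ 2 := by
  have hd := rs_dir hD hq
  obtain ⟨h3, hi, hG⟩ := hq
  have h3' : (0 : ℝ) < q 3 := by exact_mod_cast h3
  have hD' : (0 : ℝ) < D := by exact_mod_cast hD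
  have hq0 : ∀ i, (0 : ℝ) ≤ q i := fun i => by
    have h1 : (q 3 : ℝ) ≤ D * q i := by exact_mod_cast (hi i).1
    by_contra hc
    push Not at hc
    nlinarith
  have e : rsG α (rsX q) = rsG α (rsC q) / (q 3 : ℝ) ^ α := by
    unfold rsG rsX rsC
    simp only [Real.div_rpow (hq0 _) h3'.le]
    ring
  have hp : 0 < (q 3 : ℝ) ^ α := by positivity
  rw [e, abs_div, abs_of_pos hp, div_le_iff₀ hp]
  refine hG.trans ?_
  rw [Real.rpow_sub h3', show ((2 : ℝ)) = ((2 : ℕ) : ℝ) by norm_num, Real.rpow_natCast, div_eq_mul_one_div, mul_comm]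
  gcongr

set_option maxHeartbeats 1000000 in
/-- Points in one cell lie in the box attached to a representative. -/
lemma rs_cell (α : ℝ) (hα : α ≠ 0) (D : ℕ) (hD : 1 ≤ D) : ∃ C : ℝ, 1 ≤ C ∧ ∀ (N : ℝ) (q q' : Fin 4 → ℤ), 1 ≤ N →
    q ∈ rsS α D → q' ∈ rsS α D → N ≤ q 3 → N ≤ q' 3 → (q' 3 : ℝ) ≤ 2 * N →
    |rsX q' 0 - rsX q 0| ≤ 1 / N → |rsX q' 1 - rsX q 1| ≤ 1 / N → rsB α (rsX q) N C (rsC q') := by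
  have hD' : (1 : ℝ) ≤ D := by exact_mod_cast hD
  have hD0 : (0 : ℝ) < D := by linarith
  obtain ⟨L, hL0, hL⟩ := rs_expand α ((D : ℝ) ^ 2) (by nlinarith)
  obtain ⟨A, hA0, hA⟩ := rs_rpow_lip (D : ℝ)⁻¹ D α (by positivity)
  -- inverse power
  have hcont : ContinuousOn (fun x : ℝ => x ^ α) (Set.Icc (D : ℝ)⁻¹ D) := by
    apply ContinuousOn.rpow_const continuousOn_id
    intro x hx; left; simp only [id]; have := hx.1; have : 0 < (D : ℝ)⁻¹ := by positivity
    linarith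
  obtain ⟨U, hU⟩ := isCompact_Icc.exists_bound_of_continuousOn hcont
  have hcont2 : ContinuousOn (fun x : ℝ => x ^ (-α)) (Set.Icc (D : ℝ)⁻¹ D) := by
    apply ContinuousOn.rpow_const continuousOn_id
    intro x hx; left; simp only [id]; have := hx.1; have : 0 < (D : ℝ)⁻¹ := by positivity
    linarith
  obtain ⟨W, hW⟩ := isCompact_Icc.exists_bound_of_continuousOn hcont2
  have hW1 : 0 < max W 1 := by positivity
  obtain ⟨A', hA'0, hA'⟩ := rs_rpow_lip (max W 1)⁻¹ (max U 0) (α⁻¹) (by positivity)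
  set T : ℝ := 2 + 2 * A' * (2 * A + 2) with hT
  have hT0 : 0 ≤ T := by positivity
  refine ⟨T + 2 + (3 + L * T ^ 2) * |α|⁻¹ + 2, by nlinarith [show 0 ≤ (3 + L * T ^ 2) * |α|⁻¹ by positivity], ?_⟩
  intro N q q' hN hq hq' hNq hNq' hq2 h0 h1
  have hN0 : 0 < N := by linarith
  have hd := rs_dir hD hq
  have hd' := rs_dir hD hq'
  have hg := rs_GX hD hq hN0 hNq
  have hg' := rs_GX hD hq' hN0 hNq'
  have h3' : (0 : ℝ) < q' 3 := by linarith
  have hx0 : ∀ i, 0 < rsX q i := fun i => lt_of_lt_of_le (by positivity) (hd.2 i).1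
  have hx0' : ∀ i, 0 < rsX q' i := fun i => lt_of_lt_of_le (by positivity) (hd'.2 i).1
  have hNN : 1 / N ^ 2 ≤ 1 / N := by
    apply one_div_le_one_div_of_le hN0; nlinarith
  have hx2 : |rsX q' 2 - rsX q 2| ≤ A' * (2 * A + 2) / N := by
    have a0 := hA _ _ (hd'.2 0).1 (hd'.2 0).2 (hd.2 0).1 (hd.2 0).2
    have a1 := hA _ _ (hd'.2 1).1 (hd'.2 1).2 (hd.2 1).1 (hd.2 1).2
    have a0' := a0.trans (mul_le_mul_of_nonneg_left h0 hA0)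
    have a1' := a1.trans (mul_le_mul_of_nonneg_left h1 hA0)
    have b : |rsX q' 2 ^ α - rsX q 2 ^ α| ≤ (2 * A + 2) / N := by
      unfold rsG at hg hg'
      rw [hd.1] at hg
      rw [hd'.1] at hg'
      rw [abs_le] at *
      have : (2 * A + 2) / N = 2 * (A * (1 / N)) + 2 * (1 / N) := by ring
      rw [this]
      constructor <;> linarith [hg.1, hg.2, hg'.1, hg'.2, a0'.1, a0'.2, a1'.1, a1'.2]
    have rng : ∀ x : ℝ, (D : ℝ)⁻¹ ≤ x → x ≤ D → (max W 1)⁻¹ ≤ x ^ α ∧ x ^ α ≤ max U 0 := by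
      intro x hx hx'
      have hxp : 0 < x := lt_of_lt_of_le (by positivity) hx
      have u := hU x ⟨hx, hx'⟩
      have w := hW x ⟨hx, hx'⟩
      rw [Real.norm_eq_abs] at u w
      refine ⟨?_, (le_abs_self _).trans (u.trans (le_max_left _ _))⟩
      rw [Real.rpow_neg hxp.le] at w
      have w2 : (x ^ α)⁻¹ ≤ max W 1 := (le_abs_self _).trans (w.trans (le_max_left _ _))
      rw [inv_le_comm₀ hW1 (by positivity)]
      exact w2
    have c1 := rng _ (hd'.2 2).1 (hd'.2 2).2
    have c2 := rng _ (hd.2 2).1 (hd.2 2).2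
    have := hA' _ _ c1.1 c1.2 c2.1 c2.2
    rw [← Real.rpow_mul (hx0' 2).le, ← Real.rpow_mul (hx0 2).le, mul_inv_cancel₀ hα, Real.rpow_one,
      Real.rpow_one] at this
    refine this.trans ?_
    rw [mul_div_assoc]
    gcongr
  have hall : ∀ i, |rsC q' i - q' 3 * rsX q i| ≤ T := by
    have e : ∀ i, rsC q' i - q' 3 * rsX q i = q' 3 * (rsX q' i - rsX q i) := by
      intro i; unfold rsC rsX; field_simp
    intro i
    rw [e, abs_mul, abs_of_pos h3']
    have hA3 : (0 : ℝ) ≤ A' * (2 * A + 2) := by positivity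
    have gen : ∀ r c : ℝ, 0 ≤ c → r ≤ c / N → 0 ≤ r → q' 3 * r ≤ 2 * c := by
      intro r c hc hr hr0
      calc q' 3 * r ≤ (2 * N) * (c / N) := by gcongr
        _ = 2 * c := by field_simp
    fin_cases i
    · have := gen _ 1 (by norm_num) h0 (abs_nonneg _); simp only [Fin.zero_eta]; linarith
    · have := gen _ 1 (by norm_num) h1 (abs_nonneg _); simp only [Fin.mk_one]; linarith
    · have := gen _ _ hA3 hx2 (abs_nonneg _); simp only [Fin.reduceFinMk]; linarith
    · simp only [Fin.reduceFinMk]; rw [hd.1, hd'.1]; simp [hT0]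
  have hdir2 : rsDir ((D : ℝ) ^ 2) (rsX q) := by
    refine ⟨hd.1, fun i => ⟨le_trans ?_ (hd.2 i).1, (hd.2 i).2.trans (by nlinarith)⟩⟩
    apply inv_anti₀ hD0; nlinarith
  have hexp := hL (q' 3) T (rsX q) (rsC q') h3' hdir2 (by
    intro i
    have e : rsC q' i = q' 3 * rsX q' i := by unfold rsC rsX; field_simp
    rw [e]
    obtain ⟨a1, a2⟩ := hd.2 i
    obtain ⟨a3, a4⟩ := hd'.2 i
    constructor
    · rw [show ((D : ℝ) ^ 2)⁻¹ * (q' 3 * rsX q i) = q' 3 * ((D : ℝ)⁻¹ * ((D : ℝ)⁻¹ * rsX q i)) by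
        rw [sq, mul_inv]; ring]
      apply mul_le_mul_of_nonneg_left _ h3'.le
      refine le_trans ?_ a3
      have : (D : ℝ)⁻¹ * rsX q i ≤ 1 := by rw [inv_mul_le_iff₀ hD0]; linarith
      calc (D : ℝ)⁻¹ * ((D : ℝ)⁻¹ * rsX q i) ≤ (D : ℝ)⁻¹ * 1 := by gcongr
        _ = _ := mul_one _
    · rw [show (D : ℝ) ^ 2 * (q' 3 * rsX q i) = q' 3 * (D * (D * rsX q i)) by ring]
      apply mul_le_mul_of_nonneg_left _ h3'.le
      refine a4.trans ?_
      have : 1 ≤ D * rsX q i := by rw [inv_le_iff_one_le_mul₀ hD0] at a1; linarith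
      nlinarith) hall
  refine ⟨?_, ?_, ?_⟩
  · have e : rsC q' 3 = q' 3 := rfl
    rw [e, abs_of_pos h3']
    have : 0 ≤ (T + (3 + L * T ^ 2) * |α|⁻¹ + 2) * N := by positivity
    nlinarith
  · intro i
    refine (hall i).trans ?_
    nlinarith [show 0 ≤ (3 + L * T ^ 2) * |α|⁻¹ by positivity]
  · set l : ℝ := ((q' 3 : ℤ) : ℝ) with hl
    set g := rsG α (rsX q)
    set g' := rsG α (rsC q') with hg'e
    have hG' : |g'| ≤ l ^ (α - 2) := hq'.2.2
    have e1 : l ^ (α - 1) = l ^ (α - 2) * l := by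
      rw [← Real.rpow_add_one h3'.ne']; congr 1; ring
    have e2 : l ^ α = l ^ (α - 2) * l ^ 2 := by
      rw [← Real.rpow_natCast, ← Real.rpow_add h3']; congr 1; push_cast; ring
    have hp : 0 < l ^ (α - 2) := by positivity
    have hlg : l * |g| ≤ 2 / N := by
      calc l * |g| ≤ 2 * N * (1 / N ^ 2) := by gcongr
        _ = 2 / N := by field_simp
    have hl2g : l ^ 2 * |g| ≤ 4 := by
      calc l ^ 2 * |g| ≤ (2 * N) ^ 2 * (1 / N ^ 2) := by gcongr
        _ = 4 := by field_simp; norm_num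
    have hl2g' : l ^ 2 * |g| ≤ 2 * (l / N) := by
      calc l ^ 2 * |g| = l * (l * |g|) := by ring
        _ ≤ l * (2 / N) := by gcongr
        _ = _ := by ring
    have hlN : 1 ≤ l / N := by rw [le_div_iff₀ hN0]; linarith
    have m : |α| * (l * |rsL α (rsX q) (rsC q') - l * g|) ≤ (3 + L * T ^ 2) * (l / N) := by
      have : l ^ (α - 2) * (|α| * (l * |rsL α (rsX q) (rsC q') - l * g|)) ≤
          l ^ (α - 2) * ((3 + L * T ^ 2) * (l / N)) := by
        calc l ^ (α - 2) * (|α| * (l * |rsL α (rsX q) (rsC q') - l * g|))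
            = |α * l ^ (α - 1) * (rsL α (rsX q) (rsC q') - l * g)| := by
              rw [abs_mul, abs_mul, e1, abs_mul, abs_of_pos hp, abs_of_pos h3']; ring
          _ = |(g' - l ^ α * g) - (g' - l ^ α * g - α * l ^ (α - 1) * (rsL α (rsX q) (rsC q') - l * g))| := by
              congr 1; ring
          _ ≤ |g'| + l ^ α * |g| + L * l ^ (α - 2) * T ^ 2 := by
              refine (abs_sub _ _).trans (add_le_add ((abs_sub _ _).trans ?_) hexp)
              rw [abs_mul, abs_of_pos (show 0 < l ^ α by positivity)]
          _ ≤ l ^ (α - 2) * 1 + l ^ (α - 2) * (2 * (l / N)) + l ^ (α - 2) * (L * T ^ 2) := by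
              rw [e2, mul_assoc (l ^ (α - 2))]
              have := mul_le_mul_of_nonneg_left hl2g' hp.le
              nlinarith
          _ = l ^ (α - 2) * (1 + 2 * (l / N) + L * T ^ 2) := by ring
          _ ≤ _ := by
              apply mul_le_mul_of_nonneg_left _ hp.le
              nlinarith [show 0 ≤ L * T ^ 2 by positivity]
      exact le_of_mul_le_mul_left this hp
    have hα' : 0 < |α| := abs_pos.2 hα
    have m2 : |rsL α (rsX q) (rsC q') - l * g| ≤ (3 + L * T ^ 2) * |α|⁻¹ / N := by
      have : (|α| * l) * |rsL α (rsX q) (rsC q') - l * g| ≤ (|α| * l) * ((3 + L * T ^ 2) * |α|⁻¹ / N) := by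
        calc _ = |α| * (l * |rsL α (rsX q) (rsC q') - l * g|) := by ring
          _ ≤ _ := m
          _ = _ := by field_simp
      exact le_of_mul_le_mul_left this (by positivity)
    calc |rsL α (rsX q) (rsC q')| = |(rsL α (rsX q) (rsC q') - l * g) + l * g| := by congr 1; ring
      _ ≤ (3 + L * T ^ 2) * |α|⁻¹ / N + 2 / N := by
          refine (abs_add_le _ _).trans (add_le_add m2 ?_)
          rw [abs_mul, abs_of_pos h3']; exact hlg
      _ ≤ _ := by
          rw [← add_div]
          gcongr
          linarith

lemma rs_near (α : ℝ) (D : ℕ) (hD : 1 ≤ D) : ∃ m : ℝ, 0 < m ∧ ∀ (N t : ℝ) (x : Fin 4 → ℝ) (v : Fin 4 → ℤ),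
    1 ≤ N → 0 < t → t ≤ m → rsDir D x → |rsG α x| ≤ 1 / N ^ 2 → v ≠ 0 → rsB α x N t (rsC v) →
    ∃ u ∈ rsS α D, (u 3 : ℝ) ≤ t * N ∧ ∀ i, |x i - rsX u i| ≤ t / u 3 := by
  have hD' : (1 : ℝ) ≤ D := by exact_mod_cast hD
  have hD0 : (0 : ℝ) < D := by linarith
  obtain ⟨L, hL0, hL⟩ := rs_expand α ((D : ℝ) + 1) (by linarith)
  set K : ℝ := 1 + 2 * |α| + L with hK
  have hK1 : 1 ≤ K := by have := abs_nonneg α; linarith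
  refine ⟨((2 * D) * K)⁻¹, by positivity, ?_⟩
  have main : ∀ (N t : ℝ) (x : Fin 4 → ℝ) (v : Fin 4 → ℤ),
    1 ≤ N → 0 < t → t ≤ ((2 * D) * K)⁻¹ → rsDir D x → |rsG α x| ≤ 1 / N ^ 2 → 0 < v 3 → rsB α x N t (rsC v) →
    v ∈ rsS α D ∧ (v 3 : ℝ) ≤ t * N ∧ ∀ i, |x i - rsX v i| ≤ t / v 3 := by
    intro N t x v hN ht htm hx hG hv hB
    have hN0 : 0 < N := by linarith
    have htK : t * (2 * D * K) ≤ 1 := by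
      rw [← le_div_iff₀ (by positivity), one_div]; exact htm
    have htD : t * (2 * D) ≤ 1 := by
      have h := le_mul_of_one_le_right (show 0 ≤ t * (2 * D) by positivity) hK1
      linarith
    have htK2 : t * K ≤ 1 := by
      refine le_trans ?_ htK
      have : 0 ≤ t * K := by positivity
      nlinarith
    have ht1 : t ≤ 1 := by nlinarith
    have hl1 : (1 : ℝ) ≤ v 3 := by exact_mod_cast hv
    set l : ℝ := ((v 3 : ℤ) : ℝ) with hl
    have hl0 : 0 < l := by linarith
    obtain ⟨b1, b2, b3⟩ := hB
    have hc : ∀ i, rsC v i = v i := fun i => rfl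
    simp only [hc] at b2
    rw [hc, abs_of_pos hl0] at b1
    have hreg : ∀ i, v 3 ≤ D * v i ∧ v i ≤ D * v 3 := by
      intro i
      have h := abs_le.1 (b2 i)
      obtain ⟨h1, h2⟩ := hx.2 i
      have h1' : 1 ≤ D * x i := by rw [inv_le_iff_one_le_mul₀ hD0] at h1; linarith
      constructor
      · have : (v 3 : ℝ) < D * v i + 1 := by
          have e1 : D * (l * x i - t) ≤ D * v i := by
            apply mul_le_mul_of_nonneg_left _ hD0.le; linarith [h.1]
          have e2 : l * 1 ≤ l * (D * x i) := by gcongr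
          nlinarith
        have : v 3 < D * v i + 1 := by exact_mod_cast this
        omega
      · have : (v i : ℝ) < D * v 3 + 1 := by
          have : l * x i ≤ l * D := by gcongr
          have ht2 : t < 1 := by nlinarith
          linarith [h.2]
        have : v i < D * v 3 + 1 := by exact_mod_cast this
        omega
    have hx1 : ∀ i, |x i - rsX v i| ≤ t / v 3 := by
      intro i
      rw [le_div_iff₀ hl0]
      have e : |x i - rsX v i| * l = |v i - l * x i| := by
        rw [← abs_of_pos hl0, ← abs_mul, abs_of_pos hl0, abs_sub_comm]
        congr 1
        unfold rsX; rw [← hl]; field_simp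
      exact e ▸ b2 i
    refine ⟨⟨hv, hreg, ?_⟩, b1, hx1⟩
    have hdir2 : rsDir ((D : ℝ) + 1) x := by
      refine ⟨hx.1, fun i => ⟨le_trans ?_ (hx.2 i).1, (hx.2 i).2.trans (by linarith)⟩⟩
      apply inv_anti₀ hD0; linarith
    have hexp := hL l t x (rsC v) hl0 hdir2 (by
      intro i
      have h := abs_le.1 (b2 i)
      obtain ⟨h1, h2⟩ := hx.2 i
      have hxp : 0 < x i := lt_of_lt_of_le (by positivity) h1
      have h1' : 1 ≤ D * x i := by rw [inv_le_iff_one_le_mul₀ hD0] at h1; linarith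
      have e2 : l * 1 ≤ l * (D * x i) := by gcongr
      have h3 : 2 * t ≤ l * x i := by
        have : D * (2 * t) ≤ D * (l * x i) := by nlinarith
        exact le_of_mul_le_mul_left this hD0
      have hlx : 0 < l * x i := by positivity
      rw [hc]
      constructor
      · rw [inv_mul_le_iff₀ (by linarith)]
        nlinarith [h.1]
      · nlinarith [h.2]) (fun i => b2 i)
    set g := rsG α x
    have e1 : l ^ (α - 1) = l ^ (α - 2) * l := by
      rw [← Real.rpow_add_one hl0.ne']; congr 1; ring
    have e2 : l ^ α = l ^ (α - 2) * l ^ 2 := by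
      rw [← Real.rpow_natCast, ← Real.rpow_add hl0]; congr 1; push_cast; ring
    have hp : 0 < l ^ (α - 2) := by positivity
    have hlN : l / N ≤ t := by rw [div_le_iff₀ hN0]; exact b1
    have hl2g : l ^ 2 * |g| ≤ t ^ 2 := by
      calc l ^ 2 * |g| ≤ l ^ 2 * (1 / N ^ 2) := by gcongr
        _ = (l / N) ^ 2 := by field_simp
        _ ≤ t ^ 2 := by gcongr
    have hlL : l * |rsL α x (rsC v)| ≤ t ^ 2 := by
      calc l * |rsL α x (rsC v)| ≤ l * (t / N) := by gcongr
        _ = t * (l / N) := by ring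
        _ ≤ t * t := by gcongr
        _ = t ^ 2 := by ring
    calc |rsG α (rsC v)| = |(rsG α (rsC v) - l ^ α * g - α * l ^ (α - 1) * (rsL α x (rsC v) - l * g)) +
          (l ^ α * g + α * l ^ (α - 1) * (rsL α x (rsC v) - l * g))| := by congr 1; ring
      _ ≤ L * l ^ (α - 2) * t ^ 2 + (l ^ α * |g| + |α| * l ^ (α - 1) * (|rsL α x (rsC v)| + l * |g|)) := by
          refine (abs_add_le _ _).trans (add_le_add hexp ((abs_add_le _ _).trans (add_le_add ?_ ?_)))
          · rw [abs_mul, abs_of_pos (show 0 < l ^ α by positivity)]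
          · rw [abs_mul, abs_mul, abs_of_pos (show 0 < l ^ (α - 1) by positivity)]
            gcongr
            refine (abs_sub _ _).trans ?_
            rw [abs_mul, abs_of_pos hl0]
      _ = l ^ (α - 2) * (L * t ^ 2 + (l ^ 2 * |g| + |α| * (l * |rsL α x (rsC v)| + l ^ 2 * |g|))) := by
          rw [e1, e2]; ring
      _ ≤ l ^ (α - 2) * (L * t ^ 2 + (t ^ 2 + |α| * (t ^ 2 + t ^ 2))) := by gcongr
      _ = l ^ (α - 2) * (t * (t * K)) := by rw [hK]; ring
      _ ≤ l ^ (α - 2) * (1 * 1) := by gcongr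
      _ = _ := by ring
  intro N t x v hN ht htm hx hG hv hB
  rcases lt_trichotomy (v 3) 0 with h | h | h
  · obtain ⟨a, b, c⟩ := main N t x (-v) hN ht htm hx hG (by simpa using h) (by
      obtain ⟨b1, b2, b3⟩ := hB
      have hc : ∀ i, rsC (-v) i = - rsC v i := fun i => by simp [rsC]
      refine ⟨by rw [hc, abs_neg]; exact b1, fun i => ?_, ?_⟩
      · rw [hc, hc, ← abs_neg]; convert b2 i using 2; ring
      · rw [← abs_neg]; convert b3 using 2; unfold rsL; simp only [hc]; ring)
    exact ⟨_, a, b, c⟩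
  · exfalso
    apply hv
    have htD : t < 1 := by
      have : ((2 * D) * K)⁻¹ < 1 := inv_lt_one_of_one_lt₀ (by nlinarith)
      linarith
    funext i
    have := hB.2.1 i
    simp only [rsC, h, Int.cast_zero, zero_mul, sub_zero] at this
    have h2 : |(v i : ℝ)| < 1 := by linarith
    have h3 : |v i| < 1 := by exact_mod_cast h2
    simpa using Int.abs_lt_one_iff.1 h3
  · obtain ⟨a, b, c⟩ := main N t x v hN ht htm hx hG h hB
    exact ⟨_, a, b, c⟩

def det4 {R : Type*} [CommRing R] (a b c d : Fin 4 → R) : R :=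
  (a 0 * b 1 - a 1 * b 0) * (c 2 * d 3 - c 3 * d 2)
  - (a 0 * b 2 - a 2 * b 0) * (c 1 * d 3 - c 3 * d 1)
  + (a 0 * b 3 - a 3 * b 0) * (c 1 * d 2 - c 2 * d 1)
  + (a 1 * b 2 - a 2 * b 1) * (c 0 * d 3 - c 3 * d 0)
  - (a 1 * b 3 - a 3 * b 1) * (c 0 * d 2 - c 2 * d 0)
  + (a 2 * b 3 - a 3 * b 2) * (c 0 * d 1 - c 1 * d 0)

lemma det4_bound (a b c d s : Fin 4 → ℝ) (ta tb tc td : ℝ) (hs : ∀ i, 0 ≤ s i)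
    (hta : 0 ≤ ta) (htb : 0 ≤ tb) (htc : 0 ≤ tc) (htd : 0 ≤ td)
    (ha : ∀ i, |a i| ≤ ta * s i) (hb : ∀ i, |b i| ≤ tb * s i) (hc : ∀ i, |c i| ≤ tc * s i)
    (hd : ∀ i, |d i| ≤ td * s i) :
    |det4 a b c d| ≤ 24 * (ta * tb * tc * td) * (s 0 * s 1 * s 2 * s 3) := by
  have minor : ∀ (a b : Fin 4 → ℝ) (ta tb : ℝ), 0 ≤ ta → 0 ≤ tb → (∀ i, |a i| ≤ ta * s i) →
      (∀ i, |b i| ≤ tb * s i) → ∀ i j, |a i * b j - a j * b i| ≤ 2 * (ta * tb) * (s i * s j) := by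
    intro a b ta tb hta htb ha hb i j
    refine (abs_sub _ _).trans ?_
    rw [abs_mul, abs_mul]
    have h1 : |a i| * |b j| ≤ (ta * s i) * (tb * s j) :=
      mul_le_mul (ha i) (hb j) (abs_nonneg _) (mul_nonneg hta (hs i))
    have h2 : |a j| * |b i| ≤ (ta * s j) * (tb * s i) :=
      mul_le_mul (ha j) (hb i) (abs_nonneg _) (mul_nonneg hta (hs j))
    nlinarith
  have prod : ∀ i j k l : Fin 4, |(a i * b j - a j * b i) * (c k * d l - c l * d k)| ≤
      4 * (ta * tb * tc * td) * (s i * s j * s k * s l) := by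
    intro i j k l
    rw [abs_mul]
    refine (mul_le_mul (minor a b ta tb hta htb ha hb i j) (minor c d tc td htc htd hc hd k l) (abs_nonneg _) ?_).trans_eq (by ring)
    have := hs i; have := hs j; positivity
  have h1 := abs_le.1 (prod 0 1 2 3)
  have h2 := abs_le.1 (prod 0 2 1 3)
  have h3 := abs_le.1 (prod 0 3 1 2)
  have h4 := abs_le.1 (prod 1 2 0 3)
  have h5 := abs_le.1 (prod 1 3 0 2)
  have h6 := abs_le.1 (prod 2 3 0 1)
  unfold det4
  rw [abs_le]
  constructor <;> nlinarith [h1.1, h2.1, h3.1, h4.1, h5.1, h6.1, h1.2, h2.2, h3.2, h4.2, h5.2, h6.2]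

lemma rs_det (α : ℝ) (D : ℝ) (hD : 1 ≤ D) : ∃ C : ℝ, 1 ≤ C ∧ ∀ (N : ℝ) (x : Fin 4 → ℝ), 1 ≤ N →
    rsDir D x → |rsG α x| ≤ 1 / N ^ 2 → ∀ (ta tb tc td : ℝ) (a b c d : Fin 4 → ℝ),
    rsB α x N ta a → rsB α x N tb b → rsB α x N tc c → rsB α x N td d →
    |det4 a b c d| ≤ C * (ta * tb * tc * td) := by
  have hD0 : 0 < D := by linarith
  have hcont2 : ContinuousOn (fun x : ℝ => x ^ (-(α - 1))) (Set.Icc (D : ℝ)⁻¹ D) := by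
    apply ContinuousOn.rpow_const continuousOn_id
    intro x hx; left; simp only [id]; have := hx.1; have : 0 < (D : ℝ)⁻¹ := by positivity
    linarith
  obtain ⟨W, hW⟩ := isCompact_Icc.exists_bound_of_continuousOn hcont2
  refine ⟨48 * max W 1, by linarith [le_max_right W 1], ?_⟩
  intro N x hN hx hG ta tb tc td a b c d ha hb hc hd
  have hN0 : 0 < N := by linarith
  have hx0 : ∀ i, 0 < x i := fun i => lt_of_lt_of_le (by positivity) (hx.2 i).1
  set n := x 2 ^ (α - 1) with hn
  have hn0 : 0 < n := Real.rpow_pos_of_pos (hx0 2) _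
  have hnW : n⁻¹ ≤ max W 1 := by
    have := hW (x 2) (hx.2 2)
    rw [Real.norm_eq_abs, Real.rpow_neg (hx0 2).le] at this
    exact (le_abs_self _).trans (this.trans (le_max_left _ _))
  let E : (Fin 4 → ℝ) → Fin 4 → ℝ := fun y =>
    ![y 0 - y 3 * x 0, y 1 - y 3 * x 1, rsL α x y - y 3 * rsL α x x, y 3]
  let s : Fin 4 → ℝ := ![1, 1, 2 / N, N]
  have tpos : ∀ (t : ℝ) (y : Fin 4 → ℝ), rsB α x N t y → 0 ≤ t := fun t y h =>
    (abs_nonneg _).trans (h.2.1 0)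
  have hE : ∀ (t : ℝ) (y : Fin 4 → ℝ), rsB α x N t y → ∀ i, |E y i| ≤ t * s i := by
    intro t y h i
    have ht := tpos t y h
    obtain ⟨h1, h2, h3⟩ := h
    fin_cases i
    · simpa [E, s] using h2 0
    · simpa [E, s] using h2 1
    · simp only [E, s, Fin.reduceFinMk, Matrix.cons_val]
      refine (abs_sub _ _).trans ?_
      rw [abs_mul, rs_self α x hx0]
      calc |rsL α x y| + |y 3| * |rsG α x| ≤ t / N + (t * N) * (1 / N ^ 2) := by gcongr
        _ = t * (2 / N) := by field_simp; norm_num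
    · simpa [E, s] using h1
  have hbb := det4_bound (E a) (E b) (E c) (E d) s ta tb tc td (by
    intro i; fin_cases i <;> simp [s] <;> positivity) (tpos _ _ ha) (tpos _ _ hb) (tpos _ _ hc) (tpos _ _ hd)
    (hE _ _ ha) (hE _ _ hb) (hE _ _ hc) (hE _ _ hd)
  have e1 : det4 (E a) (E b) (E c) (E d) = - n * det4 a b c d := by
    have hx3 := hx.1
    have : ∀ y, rsL α x y - y 3 * rsL α x x = x 0 ^ (α - 1) * (y 0 - y 3 * x 0)
        + x 1 ^ (α - 1) * (y 1 - y 3 * x 1) - n * (y 2 - y 3 * x 2) := by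
      intro y; unfold rsL; rw [hx3]; ring
    simp only [E, det4, Matrix.cons_val, this]
    ring
  have e2 : s 0 * s 1 * s 2 * s 3 = 2 := by simp [s]; field_simp
  rw [e1, e2, abs_mul, abs_neg, abs_of_pos hn0] at hbb
  have ht := mul_nonneg (mul_nonneg (mul_nonneg (tpos _ _ ha) (tpos _ _ hb)) (tpos _ _ hc)) (tpos _ _ hd)
  calc |det4 a b c d| = n⁻¹ * (n * |det4 a b c d|) := by field_simp
    _ ≤ n⁻¹ * (24 * (ta * tb * tc * td) * 2) := by gcongr
    _ = n⁻¹ * (48 * (ta * tb * tc * td)) := by ring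
    _ ≤ max W 1 * (48 * (ta * tb * tc * td)) := by gcongr
    _ = _ := by ring

noncomputable def rsHat (α : ℝ) (x : Fin 4 → ℝ) : Fin 4 → ℝ := fun i => x i ^ (α - 1)

def rsFlip (w : Fin 4 → ℤ) : Fin 4 → ℤ := ![w 0, w 1, - w 2, - w 3]

lemma rs_dual (α α' : ℝ) (hαα : (α - 1) * (α' - 1) = 1) (D D' : ℝ) (hD : 1 ≤ D) (hD1 : 1 ≤ D') :
    ∃ C : ℝ, 1 ≤ C ∧ ∀ (N : ℝ) (x : Fin 4 → ℝ), 1 ≤ N → rsDir D x → rsDir D' (rsHat α x) →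
    |rsG α x| ≤ 1 / N ^ 2 → ∀ (k : ℝ) (w : Fin 4 → ℤ),
    (∀ (t : ℝ) (z : Fin 4 → ℝ), rsB α x N t z →
      |(w 0 : ℝ) * z 0 + w 1 * z 1 + w 2 * z 2 + w 3 * z 3| ≤ k * t) →
    rsB α' (rsHat α x) N (k * C) (rsC (rsFlip w)) := by
  refine ⟨D + 1 + D * D', by nlinarith, ?_⟩
  intro N x hN hx hx' hG k w hw
  have hN0 : 0 < N := by linarith
  have hx0 : ∀ i, 0 < x i := fun i => lt_of_lt_of_le (by positivity) (hx.2 i).1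
  have hh0 : ∀ i, 0 < x i ^ (α - 1) := fun i => Real.rpow_pos_of_pos (hx0 i) _
  have hhD : ∀ i, x i ^ (α - 1) ≤ D' := fun i => (hx'.2 i).2
  have hx3 := hx.1
  have hw3 := hw (D * N) ![0, 0, 0, 1] (by
    refine ⟨?_, fun i => ?_, ?_⟩
    · simp; nlinarith
    · fin_cases i
      · simp [abs_of_pos (hx0 0)]; nlinarith [(hx.2 0).2]
      · simp [abs_of_pos (hx0 1)]; nlinarith [(hx.2 1).2]
      · simp [abs_of_pos (hx0 2)]; nlinarith [(hx.2 2).2]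
      · simp [hx3]; positivity
    · unfold rsL; simp [hx3]
      rw [mul_div_assoc, div_self hN0.ne']; linarith)
  have hxx := hw (1 / N) x (by
    refine ⟨?_, fun i => ?_, ?_⟩
    · rw [hx3]; simp [hN0.ne']
    · rw [hx3]; simp; positivity
    · rw [rs_self α x hx0]; refine hG.trans_eq ?_; field_simp)
  simp only [Matrix.cons_val, mul_zero, zero_add, mul_one] at hw3
  have hk : 0 ≤ k := by
    have := (abs_nonneg _).trans hw3
    by_contra hc; push Not at hc
    have : k * (D * N) < 0 := mul_neg_of_neg_of_pos hc (by positivity)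
    linarith
  have bd : ∀ i, |x i| ≤ D := fun i => by rw [abs_of_pos (hx0 i)]; exact (hx.2 i).2
  have zz : ∀ (i : Fin 4) (s : ℝ), |s| ≤ D' → |s * x i| ≤ D * D' := by
    intro i s hs
    rw [abs_mul, mul_comm]
    exact mul_le_mul (bd i) hs (abs_nonneg _) (by linarith)
  have zz1 : ∀ (i : Fin 4) (s : ℝ), |s| ≤ D' → |1 - s * x i| ≤ 1 + D * D' := by
    intro i s hs
    refine (abs_sub _ _).trans ?_
    rw [abs_one]; linarith [zz i s hs]
  have zz0 : ∀ (i : Fin 4) (s : ℝ), |s| ≤ D' → |0 - s * x i| ≤ 1 + D * D' := by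
    intro i s hs
    rw [zero_sub, abs_neg]; linarith [zz i s hs]
  have zz3 : ∀ s : ℝ, |s| ≤ D' → |s| ≤ (1 + D * D') * N := by
    intro s hs
    have : D' ≤ 1 + D * D' := by nlinarith
    nlinarith [show 0 ≤ 1 + D * D' by positivity]
  have habs : ∀ i, |x i ^ (α - 1)| ≤ D' := fun i => by rw [abs_of_pos (hh0 i)]; exact hhD i
  have hz0 := hw (1 + D * D') ![1, 0, 0, x 0 ^ (α - 1)] (by
    refine ⟨?_, fun i => ?_, ?_⟩
    · simpa using zz3 _ (habs 0)
    · fin_cases i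
      · simpa using zz1 0 _ (habs 0)
      · simpa using zz0 1 _ (habs 0)
      · simpa using zz0 2 _ (habs 0)
      · simp [hx3]; positivity
    · unfold rsL; simp [hx3]; positivity)
  have hz1 := hw (1 + D * D') ![0, 1, 0, x 1 ^ (α - 1)] (by
    refine ⟨?_, fun i => ?_, ?_⟩
    · simpa using zz3 _ (habs 1)
    · fin_cases i
      · simpa using zz0 0 _ (habs 1)
      · simpa using zz1 1 _ (habs 1)
      · simpa using zz0 2 _ (habs 1)
      · simp [hx3]; positivity
    · unfold rsL; simp [hx3]; positivity)
  have hz2 := hw (1 + D * D') ![0, 0, 1, - x 2 ^ (α - 1)] (by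
    have h2 : |- x 2 ^ (α - 1)| ≤ D' := by rw [abs_neg]; exact habs 2
    refine ⟨?_, fun i => ?_, ?_⟩
    · simpa using zz3 _ (habs 2)
    · fin_cases i
      · simpa using zz0 0 _ h2
      · simpa using zz0 1 _ h2
      · simpa using zz1 2 _ h2
      · simp [hx3]; positivity
    · unfold rsL; simp [hx3]; positivity)
  simp only [Matrix.cons_val, mul_zero, zero_add, add_zero, mul_one] at hz0 hz1 hz2
  have kk : k * (1 + D * D') ≤ k * (D + 1 + D * D') := by gcongr; linarith
  refine ⟨?_, fun i => ?_, ?_⟩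
  · simp only [rsC, rsFlip, Matrix.cons_val, Int.cast_neg, abs_neg]
    refine hw3.trans ?_
    rw [← mul_assoc]
    gcongr
    nlinarith
  · fin_cases i
    · simp only [rsC, rsFlip, rsHat, Fin.zero_eta, Matrix.cons_val, Int.cast_neg]
      refine le_trans (le_of_eq ?_) (hz0.trans kk)
      congr 1; ring
    · simp only [rsC, rsFlip, rsHat, Fin.mk_one, Matrix.cons_val, Int.cast_neg]
      refine le_trans (le_of_eq ?_) (hz1.trans kk)
      congr 1; ring
    · simp only [rsC, rsFlip, rsHat, Fin.reduceFinMk, Matrix.cons_val, Int.cast_neg]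
      refine le_trans (le_of_eq ?_) (hz2.trans kk)
      rw [← abs_neg]
      congr 1; ring
    · simp only [rsC, rsFlip, rsHat, Fin.reduceFinMk, Matrix.cons_val, Int.cast_neg, hx3, Real.one_rpow]
      simp; positivity
  · have e : ∀ i, rsHat α x i ^ (α' - 1) = x i := fun i => by
      unfold rsHat; rw [← Real.rpow_mul (hx0 i).le, hαα, Real.rpow_one]
    unfold rsL
    simp only [e, rsC, rsFlip, Matrix.cons_val, Int.cast_neg]
    calc _ = |(w 0 : ℝ) * x 0 + w 1 * x 1 + w 2 * x 2 + w 3 * x 3| := by congr 1; ring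
      _ ≤ k * (1 / N) := hxx
      _ = k * 1 / N := by ring
      _ ≤ _ := by gcongr; nlinarith

lemma rsB_mono {α : ℝ} {x : Fin 4 → ℝ} {N t t' : ℝ} {y : Fin 4 → ℝ} (hN : 0 < N) (h : rsB α x N t y)
    (htt : t ≤ t') : rsB α x N t' y :=
  ⟨h.1.trans (by gcongr), fun i => (h.2.1 i).trans htt, h.2.2.trans (by gcongr)⟩

lemma rsB_smul {α : ℝ} {x : Fin 4 → ℝ} {N t : ℝ} {y : Fin 4 → ℝ} (h : rsB α x N t y)
    (c : ℝ) : rsB α x N (|c| * t) (fun i => c * y i) := by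
  have hc := abs_nonneg c
  refine ⟨?_, fun i => ?_, ?_⟩
  · rw [abs_mul, mul_assoc]; exact mul_le_mul_of_nonneg_left h.1 hc
  · rw [show c * y i - c * y 3 * x i = c * (y i - y 3 * x i) by ring, abs_mul]
    exact mul_le_mul_of_nonneg_left (h.2.1 i) hc
  · rw [show rsL α x (fun i => c * y i) = c * rsL α x y by unfold rsL; ring, abs_mul, mul_div_assoc]
    exact mul_le_mul_of_nonneg_left h.2.2 hc

lemma rsB_add {α : ℝ} {x : Fin 4 → ℝ} {N t t' : ℝ} {y z : Fin 4 → ℝ} (h : rsB α x N t y)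
    (h' : rsB α x N t' z) : rsB α x N (t + t') (fun i => y i + z i) := by
  refine ⟨?_, fun i => ?_, ?_⟩
  · rw [add_mul]; exact (abs_add_le _ _).trans (add_le_add h.1 h'.1)
  · rw [show y i + z i - (y 3 + z 3) * x i = (y i - y 3 * x i) + (z i - z 3 * x i) by ring]
    exact (abs_add_le _ _).trans (add_le_add (h.2.1 i) (h'.2.1 i))
  · rw [show rsL α x (fun i => y i + z i) = rsL α x y + rsL α x z by unfold rsL; ring, add_div]
    exact (abs_add_le _ _).trans (add_le_add h.2.2 h'.2.2)

lemma det4_cramer {R : Type*} [CommRing R] (a b c d y : Fin 4 → R) (i : Fin 4) :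
    det4 a b c d * y i = det4 y b c d * a i + det4 a y c d * b i + det4 a b y d * c i + det4 a b c y * d i := by
  fin_cases i <;> simp only [det4, Fin.zero_eta, Fin.mk_one, Fin.reduceFinMk] <;> ring

lemma det4_cast (a b c d : Fin 4 → ℤ) : ((det4 a b c d : ℤ) : ℝ) = det4 (rsC a) (rsC b) (rsC c) (rsC d) := by
  simp only [det4, rsC]; push_cast; ring

def rsF (j : Fin 4) : Fin 4 → ℤ := Pi.single j 1

lemma rsC_sub (a b : Fin 4 → ℤ) : rsC (a - b) = fun i => rsC a i - rsC b i := by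
  funext i; simp [rsC]

lemma rsC_inj {a b : Fin 4 → ℤ} (h : ∀ i, rsC a i = rsC b i) : a = b := by
  funext i; have := h i; simpa [rsC] using this

/-- Low rank case: pigeonhole in the plane. -/
lemma rs_low {α : ℝ} {x : Fin 4 → ℝ} {N C : ℝ} (hN : 0 < N) (hC : 0 ≤ C) (P : Finset (Fin 4 → ℤ)) (a b : Fin 4 → ℝ)
    (ha : rsB α x N C a) (hb : rsB α x N C b) (c1 c2 : (Fin 4 → ℤ) → ℝ)
    (h1 : ∀ y ∈ P, |c1 y| ≤ 1) (h2 : ∀ y ∈ P, |c2 y| ≤ 1)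
    (hy : ∀ y ∈ P, ∀ i, rsC y i = c1 y * a i + c2 y * b i) (hn : 16 ≤ P.card) :
    ∃ v : Fin 4 → ℤ, v ≠ 0 ∧ rsB α x N (16 * C / √(P.card)) (rsC v) := by
  set s := √(P.card : ℝ) with hs
  have hs4 : 4 ≤ s := by
    rw [hs]; apply Real.le_sqrt_of_sq_le; norm_num; exact_mod_cast hn
  have hss : s ^ 2 = P.card := Real.sq_sqrt (by positivity)
  set R : ℕ := ⌊s / 4⌋₊ with hR
  have hR1 : 1 ≤ R := by rw [hR]; apply Nat.le_floor; norm_num; linarith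
  have hR1' : (1 : ℝ) ≤ R := by exact_mod_cast hR1
  have hRle : (R : ℝ) ≤ s / 4 := Nat.floor_le (by linarith)
  have hRlt : s / 4 < R + 1 := Nat.lt_floor_add_one _
  have hRpos : (0 : ℝ) < R := by linarith
  have hmap : ∀ y ∈ P, (⌊c1 y * R⌋, ⌊c2 y * R⌋) ∈ (Finset.Icc (-(R : ℤ)) R) ×ˢ (Finset.Icc (-(R : ℤ)) R) := by
    have aux : ∀ c : ℝ, |c| ≤ 1 → ⌊c * R⌋ ∈ Finset.Icc (-(R : ℤ)) R := by
      intro c hc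
      have := abs_le.1 hc
      rw [Finset.mem_Icc]
      constructor
      · rw [Int.le_floor]; push_cast; nlinarith
      · have h : c * R ≤ R := by nlinarith
        have : (⌊c * R⌋ : ℝ) ≤ R := (Int.floor_le _).trans h
        exact_mod_cast this
    intro y hy
    exact Finset.mem_product.2 ⟨aux _ (h1 y hy), aux _ (h2 y hy)⟩
  have hcard : ((Finset.Icc (-(R : ℤ)) R) ×ˢ (Finset.Icc (-(R : ℤ)) R)).card < P.card := by
    rw [Finset.card_product, Int.card_Icc]
    have : ((R : ℤ) + 1 - -(R : ℤ)).toNat = 2 * R + 1 := by omega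
    rw [this]
    have : ((2 * R + 1) * (2 * R + 1) : ℝ) < P.card := by rw [← hss]; nlinarith
    exact_mod_cast this
  obtain ⟨y, hyP, z, hzP, hne, heq⟩ := Finset.exists_ne_map_eq_of_card_lt_of_maps_to hcard hmap
  have fl : ∀ p q : ℝ, ⌊p * R⌋ = ⌊q * R⌋ → |p - q| ≤ 1 / R := by
    intro p q h
    have := Int.abs_sub_lt_one_of_floor_eq_floor h
    rw [le_div_iff₀ hRpos]
    rw [← sub_mul, abs_mul, abs_of_pos hRpos] at this
    exact this.le
  have e1 := fl _ _ (Prod.ext_iff.1 heq).1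
  have e2 := fl _ _ (Prod.ext_iff.1 heq).2
  refine ⟨y - z, sub_ne_zero.2 hne, ?_⟩
  have hB := rsB_add (rsB_smul ha (c1 y - c1 z)) (rsB_smul hb (c2 y - c2 z))
  have e3 : (fun i => (c1 y - c1 z) * a i + (c2 y - c2 z) * b i) = rsC (y - z) := by
    rw [rsC_sub]; funext i; rw [hy y hyP, hy z hzP]; ring
  rw [e3] at hB
  refine rsB_mono hN hB ?_
  have : 1 / (R : ℝ) ≤ 8 / s := by
    rw [div_le_div_iff₀ hRpos (by linarith)]; linarith
  calc |c1 y - c1 z| * C + |c2 y - c2 z| * C ≤ (8 / s) * C + (8 / s) * C := by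
        gcongr <;> linarith
    _ = _ := by ring

lemma rs_pig (P : Finset (Fin 4 → ℤ)) (hP : P.Nonempty) (c : (Fin 4 → ℤ) → ℝ)
    (hc : ∀ p q, c (p - q) = c p - c q) (h1 : ∀ p ∈ P, |c p| ≤ 1) (p0 : Fin 4 → ℤ) (hp0 : c p0 = 1) :
    ∃ k : ℕ, 1 ≤ k ∧ ∃ Q ⊆ P, Q.Nonempty ∧ (∀ p ∈ Q, ∀ q ∈ Q, c p = c q) ∧ P.card ≤ k * Q.card ∧
    ∃ u, (u = p0 ∨ ∃ p ∈ P, ∃ q ∈ P, u = p - q) ∧ c u ≠ 0 ∧ |c u| ≤ 4 / k := by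
  classical
  set I := P.image c with hI
  have hIne : I.Nonempty := hP.image c
  have hk1 : 1 ≤ I.card := hIne.card_pos
  have hk1' : (1 : ℝ) ≤ I.card := by exact_mod_cast hk1
  refine ⟨I.card, hk1, ?_⟩
  obtain ⟨z, hz, hzmax⟩ := Finset.exists_max_image I (fun z => (P.filter (fun p => c p = z)).card) hIne
  refine ⟨P.filter (fun p => c p = z), Finset.filter_subset _ _, ?_, ?_, ?_, ?_⟩
  · obtain ⟨p, hp, rfl⟩ := Finset.mem_image.1 hz
    exact ⟨p, Finset.mem_filter.2 ⟨hp, rfl⟩⟩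
  · intro p hp q hq
    rw [(Finset.mem_filter.1 hp).2, (Finset.mem_filter.1 hq).2]
  · have := Finset.card_le_mul_card_image (f := c) P ((P.filter (fun p => c p = z)).card) hzmax
    rw [mul_comm]; exact this
  · by_cases h4 : I.card ≤ 4
    · refine ⟨p0, Or.inl rfl, by rw [hp0]; norm_num, ?_⟩
      rw [hp0, abs_one, le_div_iff₀ (by linarith)]
      have : (I.card : ℝ) ≤ 4 := by exact_mod_cast h4
      linarith
    · push Not at h4
      have hk5 : (5 : ℝ) ≤ I.card := by exact_mod_cast h4
      set k := I.card with hk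
      have hmap : ∀ z ∈ I, ⌊(z + 1) * (k / 4)⌋ ∈ Finset.Icc (0 : ℤ) (k / 2 : ℕ) := by
        intro z hz
        obtain ⟨p, hp, rfl⟩ := Finset.mem_image.1 hz
        have := abs_le.1 (h1 p hp)
        rw [Finset.mem_Icc]
        constructor
        · apply Int.floor_nonneg.2
          apply mul_nonneg <;> linarith
        · have h2 : (c p + 1) * (k / 4) ≤ (k : ℝ) / 2 := by nlinarith
          have h3 : (⌊(c p + 1) * (k / 4)⌋ : ℝ) ≤ (k : ℝ) / 2 := (Int.floor_le _).trans h2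
          have h4 : (2 * ⌊(c p + 1) * (k / 4)⌋ : ℝ) ≤ k := by linarith
          have h5 : 2 * ⌊(c p + 1) * (k / 4)⌋ ≤ (k : ℤ) := by exact_mod_cast h4
          omega
      have hcard : (Finset.Icc (0 : ℤ) (k / 2 : ℕ)).card < I.card := by
        rw [Int.card_Icc, ← hk]; omega
      obtain ⟨y, hy, z', hz', hne, heq⟩ := Finset.exists_ne_map_eq_of_card_lt_of_maps_to hcard hmap
      obtain ⟨p, hp, rfl⟩ := Finset.mem_image.1 hy
      obtain ⟨q, hq, rfl⟩ := Finset.mem_image.1 hz'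
      refine ⟨p - q, Or.inr ⟨p, hp, q, hq, rfl⟩, ?_, ?_⟩
      · rw [hc]; exact sub_ne_zero.2 hne
      · have := Int.abs_sub_lt_one_of_floor_eq_floor heq
        rw [← sub_mul, abs_mul, abs_of_pos (show 0 < (k : ℝ) / 4 by linarith)] at this
        rw [hc, le_div_iff₀ (by linarith)]
        rw [show c p + 1 - (c q + 1) = c p - c q by ring] at this
        linarith

lemma det4_sub1 {R : Type*} [CommRing R] (a a' b c d : Fin 4 → R) :
    det4 (a - a') b c d = det4 a b c d - det4 a' b c d := by simp only [det4, Pi.sub_apply]; ring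
lemma det4_sub2 {R : Type*} [CommRing R] (a a' b c d : Fin 4 → R) :
    det4 b (a - a') c d = det4 b a c d - det4 b a' c d := by simp only [det4, Pi.sub_apply]; ring
lemma det4_sub3 {R : Type*} [CommRing R] (a a' b c d : Fin 4 → R) :
    det4 b c (a - a') d = det4 b c a d - det4 b c a' d := by simp only [det4, Pi.sub_apply]; ring
lemma det4_sub4 {R : Type*} [CommRing R] (a a' b c d : Fin 4 → R) :
    det4 b c d (a - a') = det4 b c d a - det4 b c d a' := by simp only [det4, Pi.sub_apply]; ring

/-- Rank three case. -/
lemma rs_three (P : Finset (Fin 4 → ℤ)) (a b c f : Fin 4 → ℤ) (ha : a ∈ P) (hb : b ∈ P) (hc : c ∈ P)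
    (hd : det4 a b c f ≠ 0)
    (hmax : ∀ a' ∈ P, ∀ b' ∈ P, ∀ c' ∈ P, |det4 a' b' c' f| ≤ |det4 a b c f|)
    (hz : ∀ y ∈ P, det4 a b c y = 0) :
    ∃ (u1 u2 u3 : Fin 4 → ℤ) (r : ℝ), r ≠ 0 ∧ |r| ≤ 64 / P.card ∧ ∀ z : Fin 4 → ℝ,
      det4 (rsC u1) (rsC u2) (rsC u3) z = r * det4 (rsC a) (rsC b) (rsC c) z := by
  classical
  set d0 : ℝ := ((det4 a b c f : ℤ) : ℝ) with hd0
  have hd0' : d0 ≠ 0 := by rw [hd0]; exact_mod_cast hd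
  let c1 : (Fin 4 → ℤ) → ℝ := fun y => (det4 y b c f : ℤ) / d0
  let c2 : (Fin 4 → ℤ) → ℝ := fun y => (det4 a y c f : ℤ) / d0
  let c3 : (Fin 4 → ℤ) → ℝ := fun y => (det4 a b y f : ℤ) / d0
  have hs1 : ∀ p q, c1 (p - q) = c1 p - c1 q := fun p q => by
    simp only [c1, det4_sub1]; push_cast; ring
  have hs2 : ∀ p q, c2 (p - q) = c2 p - c2 q := fun p q => by
    simp only [c2, det4_sub2]; push_cast; ring
  have hs3 : ∀ p q, c3 (p - q) = c3 p - c3 q := fun p q => by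
    simp only [c3, det4_sub3]; push_cast; ring
  have hle : ∀ m : ℤ, |m| ≤ |det4 a b c f| → |(m : ℝ) / d0| ≤ 1 := fun m hm => by
    rw [abs_div, div_le_one (abs_pos.2 hd0'), hd0]; exact_mod_cast hm
  have b1 : ∀ y ∈ P, |c1 y| ≤ 1 := fun y hy => hle _ (hmax y hy b hb c hc)
  have b2 : ∀ y ∈ P, |c2 y| ≤ 1 := fun y hy => hle _ (hmax a ha y hy c hc)
  have b3 : ∀ y ∈ P, |c3 y| ≤ 1 := fun y hy => hle _ (hmax a ha b hb y hy)
  have p1 : c1 a = 1 := div_self hd0'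
  have p2 : c2 b = 1 := div_self hd0'
  have p3 : c3 c = 1 := div_self hd0'
  have a2 : c2 a = 0 := by
    have : det4 a a c f = 0 := by simp only [det4]; ring
    simp only [c2, this]; simp
  have a3 : c3 a = 0 := by
    have : det4 a b a f = 0 := by simp only [det4]; ring
    simp only [c3, this]; simp
  have bb3 : c3 b = 0 := by
    have : det4 a b b f = 0 := by simp only [det4]; ring
    simp only [c3, this]; simp
  -- representation
  have rep : ∀ y, det4 a b c y = 0 → ∀ i, rsC y i = c1 y * rsC a i + c2 y * rsC b i + c3 y * rsC c i := by
    intro y hy i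
    have h := det4_cramer a b c f y i
    rw [hy, zero_mul, add_zero] at h
    have h' : d0 * y i = (det4 y b c f : ℤ) * (a i : ℝ) + (det4 a y c f : ℤ) * (b i : ℝ) + (det4 a b y f : ℤ) * (c i : ℝ) := by
      rw [hd0]; exact_mod_cast h
    simp only [c1, c2, c3, rsC]
    field_simp
    linarith
  have zdiff : ∀ u, (∃ p ∈ P, ∃ q ∈ P, u = p - q) → det4 a b c u = 0 := by
    rintro u ⟨p, hp, q, hq, rfl⟩
    rw [det4_sub4, hz p hp, hz q hq, sub_zero]
  obtain ⟨k3, hk3, Q3, hQ3, hQ3n, hQ3c, hQ3k, u3, hu3, hu3n, hu3le⟩ := rs_pig P ⟨a, ha⟩ c3 hs3 b3 c p3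
  obtain ⟨k2, hk2, Q2, hQ2, hQ2n, hQ2c, hQ2k, u2, hu2, hu2n, hu2le⟩ :=
    rs_pig Q3 hQ3n c2 hs2 (fun y hy => b2 y (hQ3 hy)) b p2
  obtain ⟨k1, hk1, Q1, hQ1, hQ1n, hQ1c, hQ1k, u1, hu1, hu1n, hu1le⟩ :=
    rs_pig Q2 hQ2n c1 hs1 (fun y hy => b1 y (hQ3 (hQ2 hy))) a p1
  have hQ1one : Q1.card ≤ 1 := by
    rw [Finset.card_le_one]
    intro p hp q hq
    apply rsC_inj
    intro i
    rw [rep p (hz p (hQ3 (hQ2 (hQ1 hp)))), rep q (hz q (hQ3 (hQ2 (hQ1 hq)))),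
      hQ1c p hp q hq, hQ2c p (hQ1 hp) q (hQ1 hq), hQ3c p (hQ2 (hQ1 hp)) q (hQ2 (hQ1 hq))]
  have hcard : P.card ≤ k3 * k2 * k1 := by
    calc P.card ≤ k3 * Q3.card := hQ3k
      _ ≤ k3 * (k2 * (k1 * 1)) := by gcongr; exact hQ2k.trans (by gcongr; exact hQ1k.trans (by gcongr))
      _ = _ := by ring
  have za : det4 a b c a = 0 := hz a ha
  have r3 := rep u3 (by rcases hu3 with rfl | h
                        · exact hz _ hc
                        · exact zdiff _ h)
  have r2 := rep u2 (by rcases hu2 with rfl | ⟨p, hp, q, hq, h⟩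
                        · exact hz _ hb
                        · exact zdiff _ ⟨p, hQ3 hp, q, hQ3 hq, h⟩)
  have r1 := rep u1 (by rcases hu1 with rfl | ⟨p, hp, q, hq, h⟩
                        · exact hz _ ha
                        · exact zdiff _ ⟨p, hQ3 (hQ2 hp), q, hQ3 (hQ2 hq), h⟩)
  have z23 : c3 u2 = 0 := by
    rcases hu2 with rfl | ⟨p, hp, q, hq, rfl⟩
    · exact bb3
    · rw [hs3, hQ3c p hp q hq, sub_self]
  have z13 : c3 u1 = 0 := by
    rcases hu1 with rfl | ⟨p, hp, q, hq, rfl⟩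
    · exact a3
    · rw [hs3, hQ3c p (hQ2 hp) q (hQ2 hq), sub_self]
  have z12 : c2 u1 = 0 := by
    rcases hu1 with rfl | ⟨p, hp, q, hq, rfl⟩
    · exact a2
    · rw [hs2, hQ2c p hp q hq, sub_self]
  refine ⟨u1, u2, u3, c1 u1 * c2 u2 * c3 u3, mul_ne_zero (mul_ne_zero hu1n hu2n) hu3n, ?_, ?_⟩
  · rw [abs_mul, abs_mul]
    have hPpos : (0 : ℝ) < P.card := by exact_mod_cast Finset.card_pos.2 ⟨a, ha⟩
    have hk1' : (0 : ℝ) < k1 := by exact_mod_cast hk1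
    have hk2' : (0 : ℝ) < k2 := by exact_mod_cast hk2
    have hk3' : (0 : ℝ) < k3 := by exact_mod_cast hk3
    calc |c1 u1| * |c2 u2| * |c3 u3| ≤ (4 / k1) * (4 / k2) * (4 / k3) := by gcongr
      _ = 64 / (k3 * k2 * k1) := by field_simp; norm_num
      _ ≤ 64 / P.card := by
        refine div_le_div_of_nonneg_left (by norm_num) hPpos ?_
        have h := Nat.cast_le (α := ℝ).2 hcard
        rwa [Nat.cast_mul, Nat.cast_mul] at h
  · intro z
    simp only [det4, r1, r2, r3, z12, z13, z23]
    ring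

lemma rs_four (P : Finset (Fin 4 → ℤ)) (M : ℕ) (a b c d : Fin 4 → ℤ) (ha : a ∈ P) (hb : b ∈ P) (hc : c ∈ P)
    (hd : d ∈ P) (h0 : det4 a b c d ≠ 0)
    (hM : ∀ a ∈ P, ∀ b ∈ P, ∀ c ∈ P, ∀ d ∈ P, |det4 a b c d| ≤ M) : P.card ≤ (2 * M + 1) ^ 4 := by
  classical
  set I := Finset.Icc (-(M : ℤ)) M with hI
  have hIc : I.card = 2 * M + 1 := by rw [hI, Int.card_Icc]; omega
  have hmem : ∀ z : ℤ, |z| ≤ M → z ∈ I := fun z hz => by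
    rw [hI, Finset.mem_Icc]; exact abs_le.1 hz
  have := Finset.card_le_card_of_injOn (s := P) (t := I ×ˢ I ×ˢ I ×ˢ I)
    (fun y => (det4 y b c d, det4 a y c d, det4 a b y d, det4 a b c y))
    (fun y hy => by
      simp only [Finset.coe_product, Set.mem_prod, Finset.mem_coe]
      exact ⟨hmem _ (hM _ hy _ hb _ hc _ hd), hmem _ (hM _ ha _ hy _ hc _ hd),
        hmem _ (hM _ ha _ hb _ hy _ hd), hmem _ (hM _ ha _ hb _ hc _ hy)⟩)
    (fun y _ z _ h => by
      simp only [Prod.mk.injEq] at h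
      obtain ⟨h1, h2, h3, h4⟩ := h
      funext i
      have e1 := det4_cramer a b c d y i
      have e2 := det4_cramer a b c d z i
      rw [h1, h2, h3, h4, ← e2] at e1
      exact mul_left_cancel₀ h0 e1)
  rw [Finset.card_product, Finset.card_product, Finset.card_product, hIc] at this
  calc _ ≤ _ := this
    _ = _ := by ring

lemma rs_rank2 {α : ℝ} {x : Fin 4 → ℝ} {N C : ℝ} (hN : 0 < N) (hC : 0 ≤ C) (P : Finset (Fin 4 → ℤ))
    (hP : ∀ p ∈ P, rsB α x N C (rsC p))
    (h3 : ∀ a ∈ P, ∀ b ∈ P, ∀ c ∈ P, ∀ j, det4 a b c (rsF j) = 0) (hn : 16 ≤ P.card) :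
    ∃ v : Fin 4 → ℤ, v ≠ 0 ∧ rsB α x N (16 * C / √(P.card)) (rsC v) := by
  classical
  by_cases h2 : ∃ j l, ∃ a ∈ P, ∃ b ∈ P, det4 a b (rsF j) (rsF l) ≠ 0
  · obtain ⟨j, l, a0, ha0, b0, hb0, h0⟩ := h2
    obtain ⟨⟨a, b⟩, hab, hmax⟩ := Finset.exists_max_image (P ×ˢ P)
      (fun p => |det4 p.1 p.2 (rsF j) (rsF l)|) ⟨(a0, b0), Finset.mem_product.2 ⟨ha0, hb0⟩⟩
    obtain ⟨ha, hb⟩ := Finset.mem_product.1 hab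
    simp only at ha hb hmax
    have hd : 0 < |det4 a b (rsF j) (rsF l)| :=
      lt_of_lt_of_le (abs_pos.2 h0) (hmax (a0, b0) (Finset.mem_product.2 ⟨ha0, hb0⟩))
    have hd' : det4 a b (rsF j) (rsF l) ≠ 0 := abs_pos.1 hd
    set d0 : ℝ := ((det4 a b (rsF j) (rsF l) : ℤ) : ℝ) with hd0
    have hd0' : d0 ≠ 0 := by rw [hd0]; exact_mod_cast hd'
    have hle : ∀ m : ℤ, |m| ≤ |det4 a b (rsF j) (rsF l)| → |(m : ℝ) / d0| ≤ 1 := fun m hm => by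
      rw [abs_div, div_le_one (abs_pos.2 hd0'), hd0]; exact_mod_cast hm
    refine rs_low hN hC P (rsC a) (rsC b) (hP a ha) (hP b hb)
      (fun y => (det4 y b (rsF j) (rsF l) : ℤ) / d0) (fun y => (det4 a y (rsF j) (rsF l) : ℤ) / d0)
      (fun y hy => hle _ (hmax (y, b) (Finset.mem_product.2 ⟨hy, hb⟩)))
      (fun y hy => hle _ (hmax (a, y) (Finset.mem_product.2 ⟨ha, hy⟩))) ?_ hn
    intro y hy i
    have h := det4_cramer a b (rsF j) (rsF l) y i
    have z1 : det4 a b y (rsF l) = 0 := h3 a ha b hb y hy l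
    have z2 : det4 a b (rsF j) y = 0 := by
      have : det4 a b (rsF j) y = - det4 a b y (rsF j) := by simp only [det4]; ring
      rw [this, h3 a ha b hb y hy j, neg_zero]
    rw [z1, z2, zero_mul, zero_mul, add_zero, add_zero] at h
    have h' : d0 * y i = (det4 y b (rsF j) (rsF l) : ℤ) * (a i : ℝ) + (det4 a y (rsF j) (rsF l) : ℤ) * (b i : ℝ) := by
      rw [hd0]; exact_mod_cast h
    simp only [rsC]
    field_simp
    linarith
  · push Not at h2
    have hm : ∀ a ∈ P, ∀ b ∈ P, ∀ i j, a i * b j = a j * b i := by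
      intro a ha b hb
      have h01 := h2 2 3 a ha b hb
      have h02 := h2 1 3 a ha b hb
      have h03 := h2 1 2 a ha b hb
      have h12 := h2 0 3 a ha b hb
      have h13 := h2 0 2 a ha b hb
      have h23 := h2 0 1 a ha b hb
      simp [det4, rsF, Pi.single_apply] at h01 h02 h03 h12 h13 h23
      intro i j
      fin_cases i <;> fin_cases j <;> simp only [Fin.zero_eta, Fin.mk_one, Fin.reduceFinMk] <;> linarith
    by_cases h1 : ∃ i0, ∃ a ∈ P, a i0 ≠ 0
    · obtain ⟨i0, a0, ha0, h0⟩ := h1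
      obtain ⟨a, ha, hmax⟩ := Finset.exists_max_image P (fun p => |p i0|) ⟨a0, ha0⟩
      have hd : 0 < |a i0| := lt_of_lt_of_le (abs_pos.2 h0) (hmax a0 ha0)
      have hd' : (a i0 : ℝ) ≠ 0 := by exact_mod_cast abs_pos.1 hd
      refine rs_low hN hC P (rsC a) (rsC a) (hP a ha) (hP a ha)
        (fun y => (y i0 : ℝ) / a i0) (fun y => 0) ?_ (fun y hy => by simp) ?_ hn
      · intro y hy
        rw [abs_div, div_le_one (abs_pos.2 hd')]
        exact_mod_cast hmax y hy
      · intro y hy i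
        have h := hm y hy a ha i0 i
        have h' : (y i0 : ℝ) * a i = y i * a i0 := by exact_mod_cast h
        simp only [rsC]
        field_simp
        linarith
    · push Not at h1
      exfalso
      have : P.card ≤ 1 := by
        rw [Finset.card_le_one]
        intro p hp q hq
        funext i
        rw [h1 i p hp, h1 i q hq]
      omega

lemma rs_dich (α α' : ℝ) (hαα : (α - 1) * (α' - 1) = 1) (D D' : ℝ) (hD : 1 ≤ D) (hD1 : 1 ≤ D') (C1 : ℝ) (hC1 : 1 ≤ C1) :
    ∃ C : ℝ, 1 ≤ C ∧ ∀ (N : ℝ) (x : Fin 4 → ℝ), 1 ≤ N → rsDir D x → rsDir D' (rsHat α x) →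
    |rsG α x| ≤ 1 / N ^ 2 → ∀ P : Finset (Fin 4 → ℤ), (∀ p ∈ P, rsB α x N C1 (rsC p)) →
    (P.card : ℝ) ≤ C ∨ (∃ v : Fin 4 → ℤ, v ≠ 0 ∧ rsB α x N (C / √(P.card)) (rsC v)) ∨
      (∃ w : Fin 4 → ℤ, w ≠ 0 ∧ rsB α' (rsHat α x) N (C / √(P.card)) (rsC w)) := by
  classical
  obtain ⟨C2, hC2, hdet⟩ := rs_det α D hD
  obtain ⟨C3, hC3, hdual⟩ := rs_dual α α' hαα D D' hD hD1
  set M : ℕ := ⌊C2 * (C1 * C1 * C1 * C1)⌋₊ with hM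
  set K : ℝ := 64 * (C2 * (C1 * C1 * C1)) * C3 with hK
  have hK0 : 0 ≤ K := by positivity
  have hB0 : (0 : ℝ) ≤ ((2 * M + 1) ^ 4 : ℕ) := by positivity
  refine ⟨((2 * M + 1) ^ 4 : ℕ) + 16 * C1 + 16 + K, by linarith, ?_⟩
  intro N x hN hx hx' hG P hP
  have hN0 : 0 < N := by linarith
  set C : ℝ := ((2 * M + 1) ^ 4 : ℕ) + 16 * C1 + 16 + K with hC
  by_cases h16 : P.card < 16
  · left
    have : (P.card : ℝ) ≤ 16 := by exact_mod_cast h16.le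
    linarith
  push Not at h16
  have hn16 : (16 : ℝ) ≤ P.card := by exact_mod_cast h16
  by_cases h4 : ∃ a ∈ P, ∃ b ∈ P, ∃ c ∈ P, ∃ d ∈ P, det4 a b c d ≠ 0
  · obtain ⟨a, ha, b, hb, c, hc, d, hd, h0⟩ := h4
    left
    have := rs_four P M a b c d ha hb hc hd h0 (fun a ha b hb c hc d hd => by
      have h := hdet N x hN hx hG _ _ _ _ _ _ _ _ (hP a ha) (hP b hb) (hP c hc) (hP d hd)
      rw [← det4_cast] at h
      have h' : (((det4 a b c d).natAbs : ℕ) : ℝ) ≤ C2 * (C1 * C1 * C1 * C1) := by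
        rw [Nat.cast_natAbs]; push_cast; exact h
      have := Nat.le_floor h'
      rw [Int.abs_eq_natAbs]
      exact_mod_cast this)
    have h : (P.card : ℝ) ≤ ((2 * M + 1) ^ 4 : ℕ) := by exact_mod_cast this
    linarith
  push Not at h4
  right
  have hs : 1 ≤ √(P.card : ℝ) := Real.le_sqrt_of_sq_le (by linarith)
  have hs0 : 0 < √(P.card : ℝ) := by linarith
  by_cases h3 : ∃ j, ∃ a ∈ P, ∃ b ∈ P, ∃ c ∈ P, det4 a b c (rsF j) ≠ 0
  · right
    obtain ⟨j, a0, ha0, b0, hb0, c0, hc0, h0⟩ := h3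
    obtain ⟨⟨a, b, c⟩, habc, hmax⟩ := Finset.exists_max_image (P ×ˢ P ×ˢ P)
      (fun p => |det4 p.1 p.2.1 p.2.2 (rsF j)|)
      ⟨(a0, b0, c0), by simp [ha0, hb0, hc0]⟩
    simp only [Finset.mem_product] at habc
    obtain ⟨ha, hb, hc⟩ := habc
    have hd : 0 < |det4 a b c (rsF j)| :=
      lt_of_lt_of_le (abs_pos.2 h0) (hmax (a0, b0, c0) (by simp [ha0, hb0, hc0]))
    obtain ⟨u1, u2, u3, r, hr0, hr, hu⟩ := rs_three P a b c (rsF j) ha hb hc (abs_pos.1 hd)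
      (fun a' ha' b' hb' c' hc' => hmax (a', b', c') (by simp [ha', hb', hc']))
      (fun y hy => h4 a ha b hb c hc y hy)
    let w : Fin 4 → ℤ := fun i => det4 u1 u2 u3 (rsF i)
    have hw : ∀ z : Fin 4 → ℝ, (w 0 : ℝ) * z 0 + w 1 * z 1 + w 2 * z 2 + w 3 * z 3 =
        r * det4 (rsC a) (rsC b) (rsC c) z := by
      intro z
      rw [← hu]
      simp only [w, det4, rsC, rsF, Pi.single_apply]
      simp
      ring
    refine ⟨rsFlip w, ?_, ?_⟩
    · intro h
      have e0 : w 0 = 0 := by simpa [rsFlip] using congrFun h 0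
      have e1 : w 1 = 0 := by simpa [rsFlip] using congrFun h 1
      have e2 : w 2 = 0 := by simpa [rsFlip] using congrFun h 2
      have e3 : w 3 = 0 := by simpa [rsFlip] using congrFun h 3
      have := hw (rsC (rsF j))
      rw [e0, e1, e2, e3, ← det4_cast] at this
      simp at this
      rcases this with h | h
      · exact hr0 h
      · exact abs_pos.1 hd h
    · have := hdual N x hN hx hx' hG (64 / P.card * (C2 * (C1 * C1 * C1))) w (by
        intro t z hz
        have h := hdet N x hN hx hG _ _ _ _ _ _ _ _ (hP a ha) (hP b hb) (hP c hc) hz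
        rw [hw, abs_mul]
        calc |r| * |det4 (rsC a) (rsC b) (rsC c) z| ≤ 64 / P.card * (C2 * (C1 * C1 * C1 * t)) := by
              apply mul_le_mul hr h (abs_nonneg _) (by positivity)
          _ = _ := by ring)
      refine rsB_mono hN0 this ?_
      have e : 64 / (P.card : ℝ) * (C2 * (C1 * C1 * C1)) * C3 = K / P.card := by rw [hK]; ring
      rw [e]
      have hsq : √(P.card : ℝ) ≤ P.card := by
        have := Real.sq_sqrt (show (0 : ℝ) ≤ P.card by linarith)
        nlinarith
      calc K / P.card ≤ K / √P.card := by gcongr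
        _ ≤ C / √P.card := by gcongr; linarith
  · left
    push Not at h3
    obtain ⟨v, hv, hB⟩ := rs_rank2 hN0 (by linarith) P hP (fun a ha b hb c hc j => h3 j a ha b hb c hc) h16
    refine ⟨v, hv, rsB_mono hN0 hB ?_⟩
    gcongr
    linarith

lemma rs_hathat {α α' : ℝ} (hαα : (α - 1) * (α' - 1) = 1) {y : ℝ} (hy : 0 < y) :
    (y ^ (α - 1)) ^ (α' - 1) = y := by
  rw [← Real.rpow_mul hy.le, hαα, Real.rpow_one]

lemma rs_Ghat {α α' : ℝ} (hαα : (α - 1) * (α' - 1) = 1) {x : Fin 4 → ℝ} (hx : ∀ i, 0 < x i) :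
    rsG α' (rsHat α x) = rsG α x := by
  have e : (α - 1) * α' = α := by linarith
  unfold rsG rsHat
  simp only [← Real.rpow_mul (hx _).le, e]

lemma rs_key (α α' : ℝ) (hα : α ≠ 0) (hαα : (α - 1) * (α' - 1) = 1) (D D' : ℕ) (hD : 1 ≤ D) (hD1 : 1 ≤ D')
    (hcomp : ∀ x, rsDir D x → rsDir D' (rsHat α x)) :
    ∃ C : ℝ, 1 ≤ C ∧ ∀ (N : ℝ) (A B : ℤ) (P : Finset (Fin 4 → ℤ)), 1 ≤ N →
    (∀ p ∈ P, p ∈ rsS α D ∧ N ≤ p 3 ∧ (p 3 : ℝ) ≤ 2 * N ∧ ⌊N * rsX p 0⌋ = A ∧ ⌊N * rsX p 1⌋ = B) →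
    C ≤ P.card →
    (∃ u ∈ rsS α D, (u 3 : ℝ) ≤ C / √P.card * N ∧ |A / N - rsX u 0| ≤ C / √P.card / u 3 ∧
      |B / N - rsX u 1| ≤ C / √P.card / u 3) ∨
    (∃ u ∈ rsS α' D', (u 3 : ℝ) ≤ C / √P.card * N ∧ |A / N - rsX u 0 ^ (α' - 1)| ≤ C / √P.card / u 3 ∧
      |B / N - rsX u 1 ^ (α' - 1)| ≤ C / √P.card / u 3) := by
  have hDr : (1 : ℝ) ≤ D := by exact_mod_cast hD
  have hDr1 : (1 : ℝ) ≤ D' := by exact_mod_cast hD1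
  obtain ⟨C1, hC1, hcell⟩ := rs_cell α hα D hD
  obtain ⟨C2, hC2, hdich⟩ := rs_dich α α' hαα D D' hDr hDr1 C1 hC1
  obtain ⟨m, hm, hnear⟩ := rs_near α D hD
  obtain ⟨m', hm', hnear'⟩ := rs_near α' D' hD1
  obtain ⟨L, hL0, hL⟩ := rs_rpow_lip (D' : ℝ)⁻¹ D' (α' - 1) (by positivity)
  set C : ℝ := C2 + 1 + (C2 / m) ^ 2 + (C2 / m') ^ 2 + (1 + L) * C2 + 2 * C2 with hC
  have p1 : 0 ≤ (C2 / m) ^ 2 := by positivity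
  have p2 : 0 ≤ (C2 / m') ^ 2 := by positivity
  have p3 : 0 ≤ L * C2 := by positivity
  have hCge : (1 + L) * C2 ≤ C := by linarith
  have hC22 : C2 ≤ (1 + L) * C2 := by linarith
  refine ⟨C, by linarith, ?_⟩
  intro N A B P hN hP hCP
  have hN0 : 0 < N := by linarith
  have hcard : 0 < P.card := by
    have : (0 : ℝ) < P.card := by linarith
    exact_mod_cast this
  obtain ⟨q, hq⟩ := Finset.card_pos.1 hcard
  obtain ⟨hqS, hqN, hqN2, hqA, hqB⟩ := hP q hq
  have hdir := rs_dir hD hqS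
  have hG := rs_GX hD hqS hN0 hqN
  have hx0 : ∀ i, 0 < rsX q i := fun i => lt_of_lt_of_le (by positivity) (hdir.2 i).1
  have hdir' := hcomp _ hdir
  have hG' : |rsG α' (rsHat α (rsX q))| ≤ 1 / N ^ 2 := by rw [rs_Ghat hαα hx0]; exact hG
  have hfl : ∀ s t : ℝ, ⌊N * s⌋ = ⌊N * t⌋ → |s - t| ≤ 1 / N := by
    intro s t h
    have := Int.abs_sub_lt_one_of_floor_eq_floor h
    rw [← mul_sub, abs_mul, abs_of_pos hN0] at this
    rw [le_div_iff₀ hN0]; linarith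
  have hfl2 : ∀ (s : ℝ) (z : ℤ), ⌊N * s⌋ = z → |z / N - s| ≤ 1 / N := by
    intro s z h
    have h1 := Int.floor_le (N * s)
    have h2 := Int.lt_floor_add_one (N * s)
    rw [h] at h1 h2
    rw [show (z : ℝ) / N - s = (z - N * s) / N by field_simp, abs_div, abs_of_pos hN0]
    gcongr
    rw [abs_le]; constructor <;> linarith
  have hcells : ∀ p ∈ P, rsB α (rsX q) N C1 (rsC p) := by
    intro p hp
    obtain ⟨hpS, hpN, hpN2, hpA, hpB⟩ := hP p hp
    exact hcell N q p hN hqS hpS hqN hpN hpN2 (hfl _ _ (hpA.trans hqA.symm)) (hfl _ _ (hpB.trans hqB.symm))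
  set s := √(P.card : ℝ) with hs
  have hs0 : 0 < s := Real.sqrt_pos.2 (by exact_mod_cast hcard)
  have hsm : ∀ μ : ℝ, 0 < μ → (C2 / μ) ^ 2 ≤ C → C2 / s ≤ μ := by
    intro μ hμ h
    have : C2 / μ ≤ s := Real.le_sqrt_of_sq_le (h.trans hCP)
    rw [div_le_iff₀ hμ] at this
    rw [div_le_iff₀ hs0]; linarith
  have ht0 : 0 < C2 / s := by positivity
  have htC : C2 / s ≤ C / s := by gcongr; linarith
  have htL : (1 + L) * (C2 / s) ≤ C / s := by
    rw [← mul_div_assoc]; gcongr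
  rcases hdich N (rsX q) hN hdir hdir' hG P hcells with h | ⟨v, hv, hB⟩ | ⟨v, hv, hB⟩
  · exfalso; linarith
  · left
    obtain ⟨u, hu, hu3, hux⟩ := hnear N (C2 / s) (rsX q) v hN ht0 (hsm m hm (by linarith)) hdir hG hv hB
    have hu0 : (0 : ℝ) < u 3 := by exact_mod_cast hu.1
    refine ⟨u, hu, hu3.trans (by gcongr), ?_⟩
    have hinv : 1 / N ≤ C2 / s / u 3 := by
      rw [div_le_div_iff₀ hN0 hu0]; linarith
    have main : ∀ i (z : ℤ), ⌊N * rsX q i⌋ = z → |z / N - rsX u i| ≤ C / s / u 3 := by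
      intro i z hz
      have h1 := hfl2 _ _ hz
      calc |z / N - rsX u i| ≤ |z / N - rsX q i| + |rsX q i - rsX u i| := abs_sub_le _ _ _
        _ ≤ C2 / s / u 3 + C2 / s / u 3 := by linarith [hux i]
        _ = (2 * C2) / s / u 3 := by ring
        _ ≤ C / s / u 3 := by gcongr; linarith
    exact ⟨main 0 A hqA, main 1 B hqB⟩
  · right
    obtain ⟨u, hu, hu3, hux⟩ := hnear' N (C2 / s) _ v hN ht0 (hsm m' hm' (by linarith)) hdir' hG' hv hB
    have hu0 : (0 : ℝ) < u 3 := by exact_mod_cast hu.1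
    refine ⟨u, hu, hu3.trans (by gcongr), ?_⟩
    have hinv : 1 / N ≤ C2 / s / u 3 := by
      rw [div_le_div_iff₀ hN0 hu0]; linarith
    have hdu := rs_dir hD1 hu
    have main : ∀ i (z : ℤ), ⌊N * rsX q i⌋ = z → |z / N - rsX u i ^ (α' - 1)| ≤ C / s / u 3 := by
      intro i z hz
      have h1 := hfl2 _ _ hz
      have h2 := hL (rsHat α (rsX q) i) (rsX u i) (hdir'.2 i).1 (hdir'.2 i).2 (hdu.2 i).1 (hdu.2 i).2
      rw [show rsHat α (rsX q) i ^ (α' - 1) = rsX q i from rs_hathat hαα (hx0 i)] at h2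
      have h3 : L * |rsHat α (rsX q) i - rsX u i| ≤ L * (C2 / s / u 3) := mul_le_mul_of_nonneg_left (hux i) hL0
      calc |z / N - rsX u i ^ (α' - 1)| ≤ |z / N - rsX q i| + |rsX q i - rsX u i ^ (α' - 1)| := abs_sub_le _ _ _
        _ ≤ C2 / s / u 3 + L * (C2 / s / u 3) := by linarith
        _ = (1 + L) * (C2 / s) / u 3 := by ring
        _ ≤ C / s / u 3 := by gcongr
    exact ⟨main 0 A hqA, main 1 B hqB⟩

def rsA (α : ℝ) (D : ℕ) (j : ℕ) : Set (Fin 4 → ℤ) := {v | v ∈ rsS α D ∧ 2 ^ j ≤ v 3 ∧ v 3 < 2 ^ (j + 1)}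

lemma rsA_finite (α : ℝ) (D : ℕ) (j : ℕ) : (rsA α D j).Finite := by
  apply Set.Finite.subset (Set.finite_Icc (fun _ : Fin 4 => (0 : ℤ)) (fun _ => (D : ℤ) * 2 ^ (j + 1)))
  rintro v ⟨⟨h0, h1, -⟩, h2, h3⟩
  constructor
  · intro i
    have := (h1 i).1
    by_contra h
    simp only [not_le] at h
    have hD : (0 : ℤ) ≤ D := by positivity
    nlinarith
  · intro i
    have := (h1 i).2
    have hD : (0 : ℤ) ≤ D := by positivity
    simp only
    nlinarith

noncomputable def rsFs (α : ℝ) (D : ℕ) (j : ℕ) : Finset (Fin 4 → ℤ) := (rsA_finite α D j).toFinset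

noncomputable def rsa (α : ℝ) (D : ℕ) (j : ℕ) : ℝ := (rsFs α D j).card

noncomputable def rsQ (y1 y2 r : ℝ) : Finset (ℤ × ℤ) :=
  (Finset.Icc ⌈y1 - r⌉ ⌊y1 + r⌋) ×ˢ (Finset.Icc ⌈y2 - r⌉ ⌊y2 + r⌋)

lemma rsQ_card (y1 y2 r : ℝ) (hr : 1 ≤ r) : ((rsQ y1 y2 r).card : ℝ) ≤ 9 * r ^ 2 := by
  have h : ∀ y : ℝ, ((Finset.Icc ⌈y - r⌉ ⌊y + r⌋).card : ℝ) ≤ 3 * r := by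
    intro y
    rw [Int.card_Icc]
    have h1 := Int.floor_le (y + r)
    have h2 := Int.le_ceil (y - r)
    have : (((⌊y + r⌋ + 1 - ⌈y - r⌉).toNat : ℤ) : ℝ) ≤ 3 * r := by
      rw [Int.toNat_eq_max]
      push_cast
      apply max_le <;> linarith
    exact_mod_cast this
  rw [rsQ, Finset.card_product]
  push_cast
  calc _ ≤ (3 * r) * (3 * r) := mul_le_mul (h y1) (h y2) (by positivity) (by positivity)
    _ = _ := by ring

lemma rsQ_mem (y1 y2 r : ℝ) (κ : ℤ × ℤ) (h1 : |κ.1 - y1| ≤ r) (h2 : |κ.2 - y2| ≤ r) : κ ∈ rsQ y1 y2 r := by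
  have h1 := abs_le.1 h1
  have h2 := abs_le.1 h2
  rw [rsQ, Finset.mem_product, Finset.mem_Icc, Finset.mem_Icc]
  refine ⟨⟨?_, ?_⟩, ?_, ?_⟩
  · rw [Int.ceil_le]; linarith
  · rw [Int.le_floor]; linarith
  · rw [Int.ceil_le]; linarith
  · rw [Int.le_floor]; linarith

/-- covering a set of cells by keys -/
lemma rs_cover (α α' : ℝ) (D D' : ℕ) (f g : (Fin 4 → ℤ) → ℝ × ℝ) (R : ℝ) (n : ℕ)
    (hR : R < 2 ^ (n + 1)) (T : Finset (ℤ × ℤ))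
    (hT : ∀ κ ∈ T, (∃ u ∈ rsS α D, (u 3 : ℝ) ≤ R ∧ |κ.1 - (f u).1| ≤ R / u 3 ∧ |κ.2 - (f u).2| ≤ R / u 3) ∨
      (∃ u ∈ rsS α' D', (u 3 : ℝ) ≤ R ∧ |κ.1 - (g u).1| ≤ R / u 3 ∧ |κ.2 - (g u).2| ≤ R / u 3)) :
    (T.card : ℝ) ≤ 9 * R ^ 2 * ∑ i ∈ Finset.range (n + 1), (rsa α D i + rsa α' D' i) / 4 ^ i := by
  classical
  have one : ∀ (α : ℝ) (D : ℕ) (f : (Fin 4 → ℤ) → ℝ × ℝ) (T : Finset (ℤ × ℤ)),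
     (∀ κ ∈ T, (∃ u ∈ rsS α D, (u 3 : ℝ) ≤ R ∧ |κ.1 - (f u).1| ≤ R / u 3 ∧ |κ.2 - (f u).2| ≤ R / u 3)) →
     (T.card : ℝ) ≤ 9 * R ^ 2 * ∑ i ∈ Finset.range (n + 1), (rsa α D i) / 4 ^ i := by
    intro α D f T hT
    have hsub : T ⊆ (Finset.range (n + 1)).biUnion (fun i => ((rsFs α D i).filter (fun u => (u 3 : ℝ) ≤ R)).biUnion
        (fun u => rsQ (f u).1 (f u).2 (R / u 3))) := by
      intro κ hκ
      obtain ⟨u, hu, hu3, h1, h2⟩ := hT κ hκ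
      have hu0 : 0 < u 3 := hu.1
      have hnn : (u 3).toNat ≠ 0 := by omega
      have hl1 := Nat.pow_log_le_self 2 hnn
      have hl2 := Nat.lt_pow_succ_log_self (b := 2) (by norm_num) (u 3).toNat
      set i := Nat.log 2 (u 3).toNat with hi
      have hl1' : (2 : ℤ) ^ i ≤ u 3 := by
        have : ((2 ^ i : ℕ) : ℤ) ≤ ((u 3).toNat : ℤ) := by exact_mod_cast hl1
        rw [Int.toNat_of_nonneg hu0.le] at this
        exact_mod_cast this
      have hl2' : u 3 < (2 : ℤ) ^ (i + 1) := by
        have : ((u 3).toNat : ℤ) < ((2 ^ (i + 1) : ℕ) : ℤ) := by exact_mod_cast hl2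
        rw [Int.toNat_of_nonneg hu0.le] at this
        exact_mod_cast this
      rw [Finset.mem_biUnion]
      refine ⟨i, ?_, ?_⟩
      · rw [Finset.mem_range]
        have h : ((2 : ℝ) ^ i) < 2 ^ (n + 1) := by
          have : ((2 : ℝ) ^ i) ≤ u 3 := by exact_mod_cast hl1'
          linarith
        exact (pow_lt_pow_iff_right₀ (by norm_num)).1 h
      · rw [Finset.mem_biUnion]
        refine ⟨u, ?_, rsQ_mem _ _ _ _ h1 h2⟩
        rw [Finset.mem_filter]
        refine ⟨?_, hu3⟩
        rw [rsFs, Set.Finite.mem_toFinset]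
        exact ⟨hu, hl1', hl2'⟩
    have h1 : (T.card : ℝ) ≤ ∑ i ∈ Finset.range (n + 1), ∑ u ∈ (rsFs α D i).filter (fun u => (u 3 : ℝ) ≤ R),
        ((rsQ (f u).1 (f u).2 (R / u 3)).card : ℝ) := by
      have := (Finset.card_le_card hsub).trans (Finset.card_biUnion_le.trans
        (Finset.sum_le_sum fun i _ => Finset.card_biUnion_le))
      exact_mod_cast this
    refine h1.trans ?_
    rw [Finset.mul_sum]
    apply Finset.sum_le_sum
    intro i _
    have h2 : ∀ u ∈ (rsFs α D i).filter (fun u => (u 3 : ℝ) ≤ R),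
        ((rsQ (f u).1 (f u).2 (R / u 3)).card : ℝ) ≤ 9 * R ^ 2 / 4 ^ i := by
      intro u hu
      rw [Finset.mem_filter, rsFs, Set.Finite.mem_toFinset] at hu
      obtain ⟨⟨hS, hl, -⟩, hR'⟩ := hu
      have hu0 : (0 : ℝ) < u 3 := by exact_mod_cast hS.1
      have hl' : (2 : ℝ) ^ i ≤ u 3 := by exact_mod_cast hl
      refine (rsQ_card _ _ _ (by rwa [le_div_iff₀ hu0, one_mul])).trans ?_
      rw [div_pow, mul_div_assoc, show (4 : ℝ) ^ i = (2 ^ i) ^ 2 by rw [← pow_mul, mul_comm, pow_mul]; norm_num]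
      gcongr
    refine (Finset.sum_le_card_nsmul _ _ _ h2).trans ?_
    rw [nsmul_eq_mul]
    have h3 : (((rsFs α D i).filter (fun u => (u 3 : ℝ) ≤ R)).card : ℝ) ≤ rsa α D i := by
      rw [rsa]; exact_mod_cast Finset.card_filter_le _ _
    calc _ ≤ rsa α D i * (9 * R ^ 2 / 4 ^ i) := by gcongr
      _ = _ := by ring
  have hs : T ⊆ T.filter (fun κ => ∃ u ∈ rsS α D, (u 3 : ℝ) ≤ R ∧ |κ.1 - (f u).1| ≤ R / u 3 ∧ |κ.2 - (f u).2| ≤ R / u 3) ∪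
     T.filter (fun κ => ∃ u ∈ rsS α' D', (u 3 : ℝ) ≤ R ∧ |κ.1 - (g u).1| ≤ R / u 3 ∧ |κ.2 - (g u).2| ≤ R / u 3) := by
    intro κ hκ
    rw [Finset.mem_union, Finset.mem_filter, Finset.mem_filter]
    rcases hT κ hκ with h | h
    · exact Or.inl ⟨hκ, h⟩
    · exact Or.inr ⟨hκ, h⟩
  have h1 := (Finset.card_le_card hs).trans (Finset.card_union_le _ _)
  have h2 := one α D f _ (fun κ (hκ : κ ∈ T.filter (fun κ => ∃ u ∈ rsS α D, (u 3 : ℝ) ≤ R ∧ |κ.1 - (f u).1| ≤ R / u 3 ∧ |κ.2 - (f u).2| ≤ R / u 3)) => (Finset.mem_filter.1 hκ).2)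
  have h3 := one α' D' g _ (fun κ (hκ : κ ∈ T.filter (fun κ => ∃ u ∈ rsS α' D', (u 3 : ℝ) ≤ R ∧ |κ.1 - (g u).1| ≤ R / u 3 ∧ |κ.2 - (g u).2| ≤ R / u 3)) => (Finset.mem_filter.1 hκ).2)
  simp only [add_div, Finset.sum_add_distrib, mul_add]
  refine le_trans ?_ (add_le_add h2 h3)
  exact_mod_cast h1

lemma rsa_nonneg (α : ℝ) (D : ℕ) (j : ℕ) : 0 ≤ rsa α D j := by unfold rsa; positivity

set_option maxHeartbeats 800000 in
lemma rs_layer (α α' : ℝ) (hα : α ≠ 0) (hαα : (α - 1) * (α' - 1) = 1) (D D' : ℕ) (hD : 1 ≤ D) (hD1 : 1 ≤ D')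
    (hcomp : ∀ x, rsDir D x → rsDir D' (rsHat α x)) :
    ∃ (K : ℝ) (c M0 : ℕ), 0 ≤ K ∧ ∀ m0, M0 ≤ m0 → ∀ j, rsa α D j ≤ K * 4 ^ j * (4 ^ m0 +
      ∑ m ∈ Finset.Ico m0 (j + c + 1), ∑ i ∈ Finset.range (j + c - m + 1), (rsa α D i + rsa α' D' i) / 4 ^ i) := by
  classical
  obtain ⟨C, hC, hkey⟩ := rs_key α α' hα hαα D D' hD hD1 hcomp
  have hC0 : 0 < C := by linarith
  obtain ⟨c, hc⟩ := pow_unbounded_of_one_lt C (show (1 : ℝ) < 2 by norm_num)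
  obtain ⟨M0, hM0⟩ := pow_unbounded_of_one_lt C (show (1 : ℝ) < 4 by norm_num)
  refine ⟨4 * D ^ 2 + 36 * C ^ 2, c, M0, by positivity, ?_⟩
  intro m0 hm0 j
  set N : ℝ := 2 ^ j with hN
  have hN1 : 1 ≤ N := one_le_pow₀ (by norm_num)
  have hN0 : 0 < N := by linarith
  have hDr : (1 : ℝ) ≤ D := by exact_mod_cast hD
  set F := rsFs α D j with hF
  let φ : (Fin 4 → ℤ) → ℤ × ℤ := fun p => (⌊N * rsX p 0⌋, ⌊N * rsX p 1⌋)
  set cells := F.image φ with hcells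
  let n : ℤ × ℤ → ℕ := fun κ => (F.filter (fun p => φ p = κ)).card
  have hFmem : ∀ p ∈ F, p ∈ rsS α D ∧ N ≤ p 3 ∧ (p 3 : ℝ) ≤ 2 * N := by
    intro p hp
    rw [hF, rsFs, Set.Finite.mem_toFinset] at hp
    obtain ⟨h1, h2, h3⟩ := hp
    refine ⟨h1, by rw [hN]; exact_mod_cast h2, ?_⟩
    rw [pow_succ] at h3
    have : (p 3 : ℝ) < 2 ^ j * 2 := by exact_mod_cast h3
    rw [hN]; linarith
  -- number of cells
  have hcc : (cells.card : ℝ) ≤ 4 * D ^ 2 * 4 ^ j := by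
    have hsub : cells ⊆ (Finset.Icc (0 : ℤ) (D * 2 ^ j)) ×ˢ (Finset.Icc (0 : ℤ) (D * 2 ^ j)) := by
      intro κ hκ
      obtain ⟨p, hp, rfl⟩ := Finset.mem_image.1 hκ
      have hd := rs_dir hD (hFmem p hp).1
      have aux : ∀ i, ⌊N * rsX p i⌋ ∈ Finset.Icc (0 : ℤ) (D * 2 ^ j) := by
        intro i
        have h1 : 0 < rsX p i := lt_of_lt_of_le (by positivity) (hd.2 i).1
        have h2 := (hd.2 i).2
        rw [Finset.mem_Icc]
        constructor
        · exact Int.floor_nonneg.2 (by positivity)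
        · have : (⌊N * rsX p i⌋ : ℝ) ≤ D * 2 ^ j := by
            refine (Int.floor_le _).trans ?_
            rw [hN] at *; nlinarith
          exact_mod_cast this
      exact Finset.mem_product.2 ⟨aux 0, aux 1⟩
    have h := Finset.card_le_card hsub
    rw [Finset.card_product, Int.card_Icc] at h
    have e : ((D : ℤ) * 2 ^ j + 1 - 0).toNat = D * 2 ^ j + 1 := by
      have : ((D : ℤ) * 2 ^ j + 1 - 0) = ((D * 2 ^ j + 1 : ℕ) : ℤ) := by push_cast; ring
      rw [this, Int.toNat_natCast]
    rw [e] at h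
    have h' : (cells.card : ℝ) ≤ (D * 2 ^ j + 1) * (D * 2 ^ j + 1) := by exact_mod_cast h
    refine h'.trans ?_
    rw [show (4 : ℝ) ^ j = (2 ^ j) ^ 2 by rw [← pow_mul, mul_comm, pow_mul]; norm_num, ← hN]
    have : 1 ≤ (D : ℝ) * N := by nlinarith
    nlinarith
  -- keys
  have hkeys : ∀ κ ∈ cells, ∀ m, m0 ≤ m → 4 ^ m ≤ n κ →
      (∃ u ∈ rsS α D, (u 3 : ℝ) ≤ C / 2 ^ m * N ∧ |κ.1 - N * rsX u 0| ≤ C / 2 ^ m * N / u 3 ∧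
        |κ.2 - N * rsX u 1| ≤ C / 2 ^ m * N / u 3) ∨
      (∃ u ∈ rsS α' D', (u 3 : ℝ) ≤ C / 2 ^ m * N ∧ |κ.1 - N * rsX u 0 ^ (α' - 1)| ≤ C / 2 ^ m * N / u 3 ∧
        |κ.2 - N * rsX u 1 ^ (α' - 1)| ≤ C / 2 ^ m * N / u 3) := by
    intro κ hκ m hm hn
    have hnr : (4 : ℝ) ^ m ≤ n κ := by exact_mod_cast hn
    have hCn : C ≤ ((F.filter (fun p => φ p = κ)).card : ℝ) := by
      refine hM0.le.trans (le_trans ?_ hnr)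
      exact pow_le_pow_right₀ (by norm_num) (hm0.trans hm)
    have hsq : (2 : ℝ) ^ m ≤ √((F.filter (fun p => φ p = κ)).card : ℝ) := by
      apply Real.le_sqrt_of_sq_le
      rw [← pow_mul, mul_comm, pow_mul]; norm_num; exact hnr
    have hle : C / √((F.filter (fun p => φ p = κ)).card : ℝ) ≤ C / 2 ^ m := by gcongr
    have conv : ∀ (z : ℤ) (y w : ℝ), 0 < w → |z / N - y| ≤ C / √((F.filter (fun p => φ p = κ)).card : ℝ) / w →
        |z - N * y| ≤ C / 2 ^ m * N / w := by
      intro z y w hw h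
      rw [show (z : ℝ) - N * y = N * (z / N - y) by field_simp, abs_mul, abs_of_pos hN0]
      calc N * |z / N - y| ≤ N * (C / 2 ^ m / w) := by gcongr; exact h.trans (by gcongr)
        _ = _ := by ring
    have := hkey N κ.1 κ.2 (F.filter (fun p => φ p = κ)) hN1 (fun p hp => by
      rw [Finset.mem_filter] at hp
      obtain ⟨h1, h2, h3⟩ := hFmem p hp.1
      exact ⟨h1, h2, h3, congrArg Prod.fst hp.2, congrArg Prod.snd hp.2⟩) hCn
    rcases this with ⟨u, hu, h1, h2, h3⟩ | ⟨u, hu, h1, h2, h3⟩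
    · have hu0 : (0 : ℝ) < u 3 := by exact_mod_cast hu.1
      exact Or.inl ⟨u, hu, h1.trans (by gcongr), conv _ _ _ hu0 h2, conv _ _ _ hu0 h3⟩
    · have hu0 : (0 : ℝ) < u 3 := by exact_mod_cast hu.1
      exact Or.inr ⟨u, hu, h1.trans (by gcongr), conv _ _ _ hu0 h2, conv _ _ _ hu0 h3⟩
  have hmJ : ∀ κ ∈ cells, ∀ m, m0 ≤ m → 4 ^ m ≤ n κ → m ≤ j + c := by
    intro κ hκ m hm hn
    have h1 : 1 ≤ C / 2 ^ m * N := by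
      rcases hkeys κ hκ m hm hn with ⟨u, hu, h1, -⟩ | ⟨u, hu, h1, -⟩
      · have hu0 : (1 : ℝ) ≤ u 3 := by exact_mod_cast hu.1
        linarith
      · have hu0 : (1 : ℝ) ≤ u 3 := by exact_mod_cast hu.1
        linarith
    rw [div_mul_eq_mul_div, one_le_div (by positivity)] at h1
    have h2 : (2 : ℝ) ^ m ≤ 2 ^ (j + c) := by
      rw [pow_add, ← hN]; refine h1.trans ?_
      rw [mul_comm]; gcongr
    exact (pow_le_pow_iff_right₀ (by norm_num)).1 h2
  set Sg : ℕ → ℝ := fun m => ∑ i ∈ Finset.range (j + c - m + 1), (rsa α D i + rsa α' D' i) / 4 ^ i with hSg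
  have hSg0 : ∀ m, 0 ≤ Sg m := fun m => Finset.sum_nonneg fun i _ => by
    have := rsa_nonneg α D i
    have := rsa_nonneg α' D' i
    positivity
  have hT : ∀ m ∈ Finset.Ico m0 (j + c + 1), 4 ^ (m + 1) * ((cells.filter (fun κ => 4 ^ m ≤ n κ)).card : ℝ) ≤
      36 * C ^ 2 * 4 ^ j * Sg m := by
    intro m hm
    rw [Finset.mem_Ico] at hm
    have h := rs_cover α α' D D' (fun u => (N * rsX u 0, N * rsX u 1))
      (fun u => (N * rsX u 0 ^ (α' - 1), N * rsX u 1 ^ (α' - 1))) (C / 2 ^ m * N) (j + c - m) (by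
        rw [div_mul_eq_mul_div, div_lt_iff₀ (by positivity), ← pow_add,
          show j + c - m + 1 + m = c + j + 1 by omega, pow_succ, pow_add, ← hN]
        have : C * N ≤ 2 ^ c * N := by gcongr
        have : 0 < 2 ^ c * N := by positivity
        linarith) (cells.filter (fun κ => 4 ^ m ≤ n κ)) (fun κ hκ => by
        rw [Finset.mem_filter] at hκ
        exact hkeys κ hκ.1 m hm.1 hκ.2)
    have e : 9 * (C / 2 ^ m * N) ^ 2 = 9 * C ^ 2 * 4 ^ j / 4 ^ m := by
      rw [show (4 : ℝ) ^ j = (2 ^ j) ^ 2 by rw [← pow_mul, mul_comm, pow_mul]; norm_num,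
        show (4 : ℝ) ^ m = (2 ^ m) ^ 2 by rw [← pow_mul, mul_comm, pow_mul]; norm_num, hN]
      field_simp
    rw [e] at h
    calc _ ≤ (4 : ℝ) ^ (m + 1) * (9 * C ^ 2 * 4 ^ j / 4 ^ m * Sg m) := by gcongr
      _ = _ := by rw [pow_succ]; field_simp; ring
  have hn : ∀ κ ∈ cells, (n κ : ℝ) ≤ 4 ^ m0 + ∑ m ∈ Finset.Ico m0 (j + c + 1), if 4 ^ m ≤ n κ then (4 : ℝ) ^ (m + 1) else 0 := by
    intro κ hκ
    have hnn : ∀ m ∈ Finset.Ico m0 (j + c + 1), 0 ≤ if 4 ^ m ≤ n κ then (4 : ℝ) ^ (m + 1) else 0 := by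
      intro m _; split_ifs <;> positivity
    by_cases h : 4 ^ m0 ≤ n κ
    · have hnz : n κ ≠ 0 := by have : 0 < 4 ^ m0 := by positivity
                               omega
      have h1 := Nat.pow_log_le_self 4 hnz
      have h2 := Nat.lt_pow_succ_log_self (b := 4) (by norm_num) (n κ)
      have h3 : m0 ≤ Nat.log 4 (n κ) := Nat.le_log_of_pow_le (by norm_num) h
      have h4 := hmJ κ hκ _ h3 h1
      have h5 := Finset.single_le_sum hnn (Finset.mem_Ico.2 ⟨h3, Nat.lt_succ_of_le h4⟩)
      rw [if_pos h1] at h5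
      have h6 : (n κ : ℝ) ≤ 4 ^ (Nat.log 4 (n κ) + 1) := by exact_mod_cast h2.le
      have : (0 : ℝ) ≤ 4 ^ m0 := by positivity
      linarith
    · have h6 : (n κ : ℝ) ≤ 4 ^ m0 := by push Not at h; exact_mod_cast h.le
      have := Finset.sum_nonneg hnn
      linarith
  have hFc : rsa α D j = ∑ κ ∈ cells, (n κ : ℝ) := by
    rw [rsa, ← hF, Finset.card_eq_sum_card_image φ F]
    push_cast; rfl
  rw [hFc]
  calc ∑ κ ∈ cells, (n κ : ℝ) ≤ ∑ κ ∈ cells, (4 ^ m0 + ∑ m ∈ Finset.Ico m0 (j + c + 1), if 4 ^ m ≤ n κ then (4 : ℝ) ^ (m + 1) else 0) :=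
        Finset.sum_le_sum hn
    _ = cells.card * 4 ^ m0 + ∑ m ∈ Finset.Ico m0 (j + c + 1), 4 ^ (m + 1) * ((cells.filter (fun κ => 4 ^ m ≤ n κ)).card : ℝ) := by
        rw [Finset.sum_add_distrib, Finset.sum_const, nsmul_eq_mul, Finset.sum_comm]
        congr 1
        apply Finset.sum_congr rfl
        intro m _
        rw [← Finset.sum_filter, Finset.sum_const, nsmul_eq_mul, mul_comm]
    _ ≤ (4 * D ^ 2 * 4 ^ j) * 4 ^ m0 + ∑ m ∈ Finset.Ico m0 (j + c + 1), 36 * C ^ 2 * 4 ^ j * Sg m := by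
        exact add_le_add (mul_le_mul_of_nonneg_right hcc (by positivity)) (Finset.sum_le_sum hT)
    _ = 4 * D ^ 2 * 4 ^ j * 4 ^ m0 + 36 * C ^ 2 * 4 ^ j * ∑ m ∈ Finset.Ico m0 (j + c + 1), Sg m := by
        rw [Finset.mul_sum]
    _ ≤ _ := by
        have h1 : 0 ≤ ∑ m ∈ Finset.Ico m0 (j + c + 1), Sg m := Finset.sum_nonneg fun m _ => hSg0 m
        have h2 : (0 : ℝ) ≤ 4 ^ m0 := by positivity
        have h3 : (0 : ℝ) ≤ 4 ^ j := by positivity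
        have h4 : (0 : ℝ) ≤ 36 * C ^ 2 * 4 ^ j * 4 ^ m0 := by positivity
        have h6 : (0 : ℝ) ≤ 4 * D ^ 2 * 4 ^ j := by positivity
        have h5 := mul_nonneg h6 h1
        generalize (∑ m ∈ Finset.Ico m0 (j + c + 1), Sg m) = Z at *
        linarith

lemma rs_geom (R : ℝ) (hR : 1 < R) (n : ℕ) : ∑ i ∈ Finset.range (n + 1), R ^ i ≤ R / (R - 1) * R ^ n := by
  rw [geom_sum_eq hR.ne', div_mul_eq_mul_div, pow_succ]
  have : 0 < R - 1 := by linarith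
  gcongr
  linarith

lemma rs_rec (b : ℕ → ℝ) (K : ℝ) (c M0 : ℕ) (hK : 0 ≤ K)
    (h : ∀ m0, M0 ≤ m0 → ∀ j, b j ≤ K * (4 ^ m0 +
      ∑ m ∈ Finset.Ico m0 (j + c + 1), ∑ i ∈ Finset.range (j + c - m + 1), b i)) (R : ℝ) (hR : 1 < R) :
    ∃ B : ℝ, 0 ≤ B ∧ ∀ j, b j ≤ B * R ^ j := by
  have hR0 : 0 < R := by linarith
  set g : ℝ := R / (R - 1) with hg
  have hg0 : 0 ≤ g := div_nonneg hR0.le (by linarith)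
  obtain ⟨μ, hμ⟩ := pow_unbounded_of_one_lt (2 * (K * (g * g)) * R ^ c) hR
  set m0 := M0 + μ + c + 1 with hm0
  have hRm : 2 * (K * (g * g)) * R ^ c ≤ R ^ m0 := by
    refine hμ.le.trans (pow_le_pow_right₀ hR.le (by omega))
  refine ⟨2 * (K * 4 ^ m0), by positivity, ?_⟩
  set B := 2 * (K * 4 ^ m0) with hB
  have hB0 : 0 ≤ B := by positivity
  intro j
  induction j using Nat.strong_induction_on with
  | _ j ih =>
    refine (h m0 (by omega) j).trans ?_
    have hj1 : 1 ≤ R ^ j := one_le_pow₀ hR.le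
    have hin : ∀ m ∈ Finset.Ico m0 (j + c + 1), ∑ i ∈ Finset.range (j + c - m + 1), b i ≤
        B * g * R ^ (j + c - m) := by
      intro m hm
      rw [Finset.mem_Ico] at hm
      calc ∑ i ∈ Finset.range (j + c - m + 1), b i ≤ ∑ i ∈ Finset.range (j + c - m + 1), B * R ^ i := by
            apply Finset.sum_le_sum
            intro i hi
            rw [Finset.mem_range] at hi
            exact ih i (by omega)
        _ = B * ∑ i ∈ Finset.range (j + c - m + 1), R ^ i := by rw [Finset.mul_sum]
        _ ≤ B * (g * R ^ (j + c - m)) := mul_le_mul_of_nonneg_left (rs_geom R hR _) hB0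
        _ = _ := by ring
    have hout : ∑ m ∈ Finset.Ico m0 (j + c + 1), R ^ (j + c - m) ≤ g * (R ^ (j + c) / R ^ m0) := by
      by_cases hm : m0 ≤ j + c
      · have e : ∑ m ∈ Finset.Ico m0 (j + c + 1), R ^ (j + c - m) = ∑ n ∈ Finset.range (j + c - m0 + 1), R ^ n := by
          rw [Finset.sum_Ico_eq_sum_range, ← Finset.sum_range_reflect]
          rw [show j + c + 1 - m0 = j + c - m0 + 1 by omega]
          apply Finset.sum_congr rfl
          intro i hi
          rw [Finset.mem_range] at hi
          congr 1
          omega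
        rw [e]
        refine (rs_geom R hR _).trans (le_of_eq ?_)
        rw [pow_sub₀ R hR0.ne' hm, div_eq_mul_inv (R ^ (j + c))]
      · rw [Finset.Ico_eq_empty (by omega), Finset.sum_empty]
        positivity
    have h1 : ∑ m ∈ Finset.Ico m0 (j + c + 1), ∑ i ∈ Finset.range (j + c - m + 1), b i ≤
        B * g * (g * (R ^ (j + c) / R ^ m0)) := by
      refine (Finset.sum_le_sum hin).trans ?_
      rw [← Finset.mul_sum]
      exact mul_le_mul_of_nonneg_left hout (by positivity)
    have h2 : K * (B * g * (g * (R ^ (j + c) / R ^ m0))) ≤ B / 2 * R ^ j := by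
      have e : K * (B * g * (g * (R ^ (j + c) / R ^ m0))) = (B / 2 * R ^ j) * ((2 * (K * (g * g)) * R ^ c) / R ^ m0) := by
        rw [pow_add]; ring
      rw [e]
      apply mul_le_of_le_one_right (by positivity)
      rw [div_le_one (by positivity)]
      exact hRm
    calc _ ≤ K * (4 ^ m0 + B * g * (g * (R ^ (j + c) / R ^ m0))) := by gcongr
      _ ≤ B / 2 + B / 2 * R ^ j := by rw [mul_add]; apply add_le_add _ h2; rw [hB]; linarith
      _ ≤ _ := by nlinarith

lemma rs_comp (α D D' : ℝ) (hα : α ≤ 1) (hD : 1 ≤ D) (h : D ^ (1 - α) ≤ D') (x : Fin 4 → ℝ) (hx : rsDir D x) :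
    rsDir D' (rsHat α x) := by
  have hD0 : 0 < D := by linarith
  have hp : 0 < D ^ (1 - α) := by positivity
  refine ⟨by simp [rsHat, hx.1], fun i => ?_⟩
  obtain ⟨h1, h2⟩ := hx.2 i
  have hx0 : 0 < x i := lt_of_lt_of_le (by positivity) h1
  constructor
  · have := Real.rpow_le_rpow_of_nonpos hx0 h2 (show α - 1 ≤ 0 by linarith)
    refine le_trans ?_ this
    rw [show α - 1 = -(1 - α) by ring, Real.rpow_neg hD0.le]
    gcongr
  · have := Real.rpow_le_rpow_of_nonpos (by positivity) h1 (show α - 1 ≤ 0 by linarith)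
    refine le_trans this ?_
    rw [show α - 1 = -(1 - α) by ring, Real.inv_rpow hD0.le, Real.rpow_neg hD0.le, inv_inv]
    exact h

lemma rs_sum_mono (b : ℕ → ℝ) (hb : ∀ i, 0 ≤ b i) (m0 j c c' : ℕ) (hc : c ≤ c') :
    ∑ m ∈ Finset.Ico m0 (j + c + 1), ∑ i ∈ Finset.range (j + c - m + 1), b i ≤
    ∑ m ∈ Finset.Ico m0 (j + c' + 1), ∑ i ∈ Finset.range (j + c' - m + 1), b i := by
  calc _ ≤ ∑ m ∈ Finset.Ico m0 (j + c + 1), ∑ i ∈ Finset.range (j + c' - m + 1), b i := by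
        apply Finset.sum_le_sum
        intro m _
        apply Finset.sum_le_sum_of_subset_of_nonneg
        · intro i hi; rw [Finset.mem_range] at *; omega
        · intro i _ _; exact hb i
    _ ≤ _ := by
        apply Finset.sum_le_sum_of_subset_of_nonneg
        · intro i hi; rw [Finset.mem_Ico] at *; omega
        · intro i _ _; exact Finset.sum_nonneg fun i _ => hb i

lemma rs_count (k : ℕ) (hk : 2 ≤ k) (R : ℝ) (hR : 1 < R) :
    ∃ B : ℝ, 0 ≤ B ∧ ∀ j, rsa (1 / k) (2 ^ k) j ≤ B * R ^ j * 4 ^ j := by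
  have hk' : (2 : ℝ) ≤ k := by exact_mod_cast hk
  have hk0 : (k : ℝ) ≠ 0 := by positivity
  have hk1 : (k : ℝ) - 1 ≠ 0 := by linarith
  set α : ℝ := 1 / k with hα
  set α' : ℝ := -(1 / ((k : ℝ) - 1)) with hα'
  have hα1 : 1 - α = ((k : ℝ) - 1) / k := by rw [hα]; field_simp
  have hα1' : 1 - α' = (k : ℝ) / (k - 1) := by rw [hα']; field_simp; ring
  have hαα : (α - 1) * (α' - 1) = 1 := by
    have : (1 - α) * (1 - α') = 1 := by rw [hα1, hα1']; field_simp
    linarith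
  have hα0 : α ≠ 0 := by rw [hα]; positivity
  have hα0' : α' ≠ 0 := by rw [hα']; exact neg_ne_zero.2 (one_div_ne_zero hk1)
  have hkc : ((k - 1 : ℕ) : ℝ) = k - 1 := by rw [Nat.cast_sub (by omega)]; simp
  have c1 : ((2 ^ k : ℕ) : ℝ) ^ (1 - α) ≤ ((2 ^ (k - 1) : ℕ) : ℝ) := by
    rw [hα1]; push_cast
    rw [← Real.rpow_natCast, ← Real.rpow_mul (by norm_num), ← Real.rpow_natCast, hkc]
    rw [mul_div_cancel₀ _ hk0]
  have c2 : ((2 ^ (k - 1) : ℕ) : ℝ) ^ (1 - α') ≤ ((2 ^ k : ℕ) : ℝ) := by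
    rw [hα1']; push_cast
    rw [← Real.rpow_natCast, ← Real.rpow_mul (by norm_num), ← Real.rpow_natCast, hkc]
    rw [mul_div_cancel₀ _ hk1]
  have o1 : 1 ≤ 2 ^ k := Nat.one_le_two_pow
  have o2 : 1 ≤ 2 ^ (k - 1) := Nat.one_le_two_pow
  have le1 : α ≤ 1 := by
    have : 0 ≤ 1 - α := by rw [hα1]; apply div_nonneg <;> linarith
    linarith
  have le2 : α' ≤ 1 := by
    have : 0 ≤ 1 - α' := by rw [hα1']; apply div_nonneg <;> linarith
    linarith
  obtain ⟨K1, cc1, M1, hK1, h1⟩ := rs_layer α α' hα0 hαα (2 ^ k) (2 ^ (k - 1)) o1 o2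
    (rs_comp α _ _ le1 (by exact_mod_cast o1) c1)
  obtain ⟨K2, cc2, M2, hK2, h2⟩ := rs_layer α' α hα0' (by linarith) (2 ^ (k - 1)) (2 ^ k) o2 o1
    (rs_comp α' _ _ le2 (by exact_mod_cast o2) c2)
  let b : ℕ → ℝ := fun i => (rsa α (2 ^ k) i + rsa α' (2 ^ (k - 1)) i) / 4 ^ i
  have hb : ∀ i, 0 ≤ b i := fun i => by
    have := rsa_nonneg α (2 ^ k) i
    have := rsa_nonneg α' (2 ^ (k - 1)) i
    simp only [b]; positivity
  obtain ⟨B, hB, hfin⟩ := rs_rec b (K1 + K2) (max cc1 cc2) (max M1 M2) (by positivity) (by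
    intro m0 hm0 j
    have e1 := h1 m0 ((le_max_left _ _).trans hm0) j
    have e2 := h2 m0 ((le_max_right _ _).trans hm0) j
    have s1 := rs_sum_mono b hb m0 j cc1 (max cc1 cc2) (le_max_left _ _)
    have s2 := rs_sum_mono b hb m0 j cc2 (max cc1 cc2) (le_max_right _ _)
    simp only [add_comm (rsa α' (2 ^ (k - 1)) _)] at e2
    change _ ≤ K1 * 4 ^ j * (4 ^ m0 + ∑ m ∈ Finset.Ico m0 (j + cc1 + 1), ∑ i ∈ Finset.range (j + cc1 - m + 1), b i) at e1
    change _ ≤ K2 * 4 ^ j * (4 ^ m0 + ∑ m ∈ Finset.Ico m0 (j + cc2 + 1), ∑ i ∈ Finset.range (j + cc2 - m + 1), b i) at e2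
    have h4 : (0 : ℝ) < 4 ^ j := by positivity
    change (rsa α (2 ^ k) j + rsa α' (2 ^ (k - 1)) j) / 4 ^ j ≤ _
    rw [div_le_iff₀ h4]
    have f1 := mul_le_mul_of_nonneg_left s1 (mul_nonneg hK1 h4.le)
    have f2 := mul_le_mul_of_nonneg_left s2 (mul_nonneg hK2 h4.le)
    linarith) R hR
  refine ⟨B, hB, fun j => ?_⟩
  have h := hfin j
  have h4 : (0 : ℝ) < 4 ^ j := by positivity
  change (rsa α (2 ^ k) j + rsa α' (2 ^ (k - 1)) j) / 4 ^ j ≤ _ at h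
  rw [div_le_iff₀ h4] at h
  linarith [rsa_nonneg α' (2 ^ (k - 1)) j]

lemma rs_shift {ι : Type*} [DecidableEq ι] (P : Finset ι) (f : ι → ℤ) (s : ℤ) :
    ((P ×ˢ P).filter (fun r => f r.1 = f r.2 + s)).card ≤ ((P ×ˢ P).filter (fun r => f r.1 = f r.2)).card := by
  classical
  set I := P.image f with hI
  let h : ℤ → ℕ := fun β => (P.filter (fun p => f p = β)).card
  have key : ∀ s : ℤ, ((P ×ˢ P).filter (fun r => f r.1 = f r.2 + s)).card = ∑ β ∈ I, h (β + s) * h β := by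
    intro s
    rw [Finset.card_eq_sum_card_fiberwise (f := fun r : ι × ι => f r.2) (t := I)]
    · apply Finset.sum_congr rfl
      intro β _
      rw [← Finset.card_product]
      congr 1
      ext ⟨p, q⟩
      simp only [Finset.mem_filter, Finset.mem_product]
      constructor
      · rintro ⟨⟨⟨hp, hq⟩, h1⟩, h2⟩
        exact ⟨⟨hp, by rw [h1, h2]⟩, hq, h2⟩
      · rintro ⟨⟨hp, h1⟩, hq, h2⟩
        exact ⟨⟨⟨hp, hq⟩, by rw [h1, h2]⟩, h2⟩
    · intro r hr
      simp only [Finset.coe_filter, Finset.mem_product, Set.mem_ofPred_eq] at hr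
      exact Finset.mem_coe.2 (Finset.mem_image_of_mem f hr.1.2)
  have k0 := key 0
  simp only [add_zero] at k0
  rw [key s, k0]
  have hsh : ∑ β ∈ I, h (β + s) * h (β + s) ≤ ∑ β ∈ I, h β * h β := by
    have e : ∑ β ∈ I, h (β + s) * h (β + s) = ∑ β ∈ I.image (· + s), h β * h β := by
      symm
      exact Finset.sum_image (fun x _ y _ hxy => by simpa using hxy)
    rw [e]
    apply Finset.sum_le_sum_of_ne_zero
    intro β _ hne
    have hpos : 0 < h β := by
      rcases Nat.eq_zero_or_pos (h β) with h0 | h0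
      · rw [h0] at hne; simp at hne
      · exact h0
    obtain ⟨p, hp⟩ := Finset.card_pos.1 hpos
    rw [Finset.mem_filter] at hp
    rw [← hp.2]
    exact Finset.mem_image_of_mem f hp.1
  have : 2 * ∑ β ∈ I, h (β + s) * h β ≤ ∑ β ∈ I, h (β + s) * h (β + s) + ∑ β ∈ I, h β * h β := by
    rw [Finset.mul_sum, ← Finset.sum_add_distrib]
    apply Finset.sum_le_sum
    intro β _
    have := two_mul_le_add_sq (h (β + s)) (h β)
    nlinarith
  omega

lemma rs_bins {ι : Type*} [DecidableEq ι] (P : Finset ι) (g : ι → ℝ) (W T : ℝ) (hW : 0 < W) (hT : 0 < T) :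
    (((P ×ˢ P).filter (fun r => |g r.1 - g r.2| < T)).card : ℝ) ≤
      (2 * (T / W) + 3) * ((P ×ˢ P).filter (fun r => |g r.1 - g r.2| < W)).card := by
  classical
  let f : ι → ℤ := fun p => ⌊g p / W⌋
  set H : ℤ := ⌈T / W⌉ with hH
  have hH0 : 0 < H := Int.ceil_pos.2 (by positivity)
  have hsub : (P ×ˢ P).filter (fun r => |g r.1 - g r.2| < T) ⊆
      (Finset.Icc (-H) H).biUnion (fun s => (P ×ˢ P).filter (fun r => f r.1 = f r.2 + s)) := by
    intro r hr
    rw [Finset.mem_filter] at hr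
    rw [Finset.mem_biUnion]
    refine ⟨f r.1 - f r.2, ?_, by rw [Finset.mem_filter]; exact ⟨hr.1, by ring⟩⟩
    have h1 := abs_lt.1 hr.2
    have a1 := Int.floor_le (g r.1 / W)
    have a2 := Int.lt_floor_add_one (g r.1 / W)
    have b1 := Int.floor_le (g r.2 / W)
    have b2 := Int.lt_floor_add_one (g r.2 / W)
    have hc := Int.le_ceil (T / W)
    have d1 : g r.1 / W - g r.2 / W < T / W := by rw [← sub_div]; gcongr; exact h1.2
    have d2 : g r.2 / W - g r.1 / W < T / W := by rw [← sub_div]; gcongr; linarith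
    have e1 : ((f r.1 - f r.2 : ℤ) : ℝ) < (H + 1 : ℤ) := by push_cast; simp only [f]; linarith
    have e2 : ((f r.2 - f r.1 : ℤ) : ℝ) < (H + 1 : ℤ) := by push_cast; simp only [f]; linarith
    have e1' := Int.cast_lt.1 e1
    have e2' := Int.cast_lt.1 e2
    rw [Finset.mem_Icc]; omega
  have hE : ((P ×ˢ P).filter (fun r => f r.1 = f r.2)).card ≤ ((P ×ˢ P).filter (fun r => |g r.1 - g r.2| < W)).card := by
    apply Finset.card_le_card
    intro r hr
    rw [Finset.mem_filter] at *
    refine ⟨hr.1, ?_⟩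
    have := Int.abs_sub_lt_one_of_floor_eq_floor hr.2
    rw [← sub_div, abs_div, abs_of_pos hW, div_lt_one hW] at this
    exact this
  have h1 := (Finset.card_le_card hsub).trans (Finset.card_biUnion_le.trans
    (Finset.sum_le_card_nsmul _ _ _ (fun s _ => (rs_shift P f s).trans hE)))
  rw [nsmul_eq_mul, Int.card_Icc] at h1
  have h2 : ((H + 1 - -H).toNat : ℝ) ≤ 2 * (T / W) + 3 := by
    have e : (((H + 1 - -H).toNat : ℤ) : ℝ) = 2 * H + 1 := by
      rw [Int.toNat_of_nonneg (by omega)]; push_cast; ring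
    have := Int.ceil_lt_add_one (T / W)
    rw [← hH] at this
    have e' : ((H + 1 - -H).toNat : ℝ) = 2 * H + 1 := by exact_mod_cast e
    linarith
  calc _ ≤ ((H + 1 - -H).toNat : ℝ) * (((P ×ˢ P).filter (fun r => |g r.1 - g r.2| < W)).card : ℝ) := by exact_mod_cast h1
    _ ≤ _ := by gcongr

lemma rs_small (k : ℕ) (hk : 2 ≤ k) (ε : ℝ) (hε : 0 < ε) : ∃ C : ℝ, 0 < C ∧ ∀ N : ℝ, 1 ≤ 2 * N →
    ((((Finset.Ioc ⌊N⌋₊ ⌊2 * N⌋₊ ×ˢ Finset.Ioc ⌊N⌋₊ ⌊2 * N⌋₊) ×ˢ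
      (Finset.Ioc ⌊N⌋₊ ⌊2 * N⌋₊ ×ˢ Finset.Ioc ⌊N⌋₊ ⌊2 * N⌋₊)).filter (fun r =>
        |((r.1.1 : ℝ) ^ (1 / (k : ℝ)) + (r.1.2 : ℝ) ^ (1 / (k : ℝ))) -
          ((r.2.1 : ℝ) ^ (1 / (k : ℝ)) + (r.2.2 : ℝ) ^ (1 / (k : ℝ)))| < N ^ (1 / (k : ℝ)) / (4 * N ^ 2))).card : ℝ)
      ≤ C * N ^ ε * N ^ 2 := by
  classical
  have hk' : (2 : ℝ) ≤ k := by exact_mod_cast hk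
  set α : ℝ := 1 / k with hα
  have hα0 : 0 < α := by rw [hα]; positivity
  have hα1 : α ≤ 1 := by rw [hα, div_le_one (by linarith)]; linarith
  set R : ℝ := 2 ^ ε with hR
  have hR1 : 1 < R := Real.one_lt_rpow (by norm_num) hε
  obtain ⟨B, hB, hcount⟩ := rs_count k hk R hR1
  have h4R : 1 < R * 4 := by linarith
  set g : ℝ := (R * 4) / (R * 4 - 1) with hg
  have hg0 : 0 ≤ g := div_nonneg (by linarith) (by linarith)
  refine ⟨B * g * (2 ^ ε * 4) + 1, by positivity, ?_⟩
  intro N hN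
  have hN0 : 0 < N := by linarith
  set E := Finset.Ioc ⌊N⌋₊ ⌊2 * N⌋₊ with hE
  have hEm : ∀ n ∈ E, N < (n : ℝ) ∧ (n : ℝ) ≤ 2 * N := by
    intro n hn
    rw [hE, Finset.mem_Ioc] at hn
    exact ⟨(Nat.floor_lt hN0.le).1 hn.1, (Nat.le_floor_iff (by linarith)).1 hn.2⟩
  set J := Nat.log 2 ⌊2 * N⌋₊ with hJ
  have hfl : 1 ≤ ⌊2 * N⌋₊ := Nat.le_floor (by simpa using hN)
  have hJN : (2 : ℝ) ^ J ≤ 2 * N := by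
    have h := Nat.pow_log_le_self 2 (show ⌊2 * N⌋₊ ≠ 0 by omega)
    have h' : ((2 : ℝ) ^ J) ≤ (⌊2 * N⌋₊ : ℝ) := by exact_mod_cast h
    exact h'.trans (Nat.floor_le (by linarith))
  set T := ((E ×ˢ E) ×ˢ (E ×ˢ E)).filter (fun r =>
        |((r.1.1 : ℝ) ^ α + (r.1.2 : ℝ) ^ α) -
          ((r.2.1 : ℝ) ^ α + (r.2.2 : ℝ) ^ α)| < N ^ α / (4 * N ^ 2)) with hT
  have hcard : T.card ≤ ((Finset.range (J + 1)).biUnion (fun j => rsFs α (2 ^ k) j)).card := by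
    apply Finset.card_le_card_of_injOn (fun r : (ℕ × ℕ) × (ℕ × ℕ) => (![(r.1.1 : ℤ), r.1.2, r.2.1, r.2.2] : Fin 4 → ℤ))
    · rintro ⟨⟨a, b⟩, c, d⟩ hr
      rw [Finset.mem_coe, hT, Finset.mem_filter] at hr
      simp only [Finset.mem_product] at hr
      obtain ⟨⟨⟨ha, hb⟩, hc, hd⟩, hlt⟩ := hr
      obtain ⟨ha1, ha2⟩ := hEm a ha
      obtain ⟨hb1, hb2⟩ := hEm b hb
      obtain ⟨hc1, hc2⟩ := hEm c hc
      obtain ⟨hd1, hd2⟩ := hEm d hd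
      have hd0 : (0 : ℝ) < d := by linarith
      have hd0' : 0 < d := by exact_mod_cast hd0
      have hdl1 := Nat.pow_log_le_self 2 hd0'.ne'
      have hdl2 := Nat.lt_pow_succ_log_self (b := 2) (by norm_num) d
      have hdJ : Nat.log 2 d ≤ J := Nat.log_mono_right ((Nat.le_floor_iff (by linarith)).2 hd2)
      simp only [Finset.coe_biUnion, Set.mem_iUnion, Finset.mem_coe]
      refine ⟨Nat.log 2 d, Finset.mem_range.2 (by omega), ?_⟩
      rw [rsFs, Set.Finite.mem_toFinset]
      have hpow : ∀ n : ℕ, N < (n : ℝ) → (n : ℝ) ≤ 2 * N → (d : ℤ) ≤ ((2 ^ k : ℕ) : ℤ) * n ∧ (n : ℤ) ≤ ((2 ^ k : ℕ) : ℤ) * d := by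
        intro n h1 h2
        have h4 : (2 : ℕ) ^ 1 ≤ 2 ^ k := Nat.pow_le_pow_right (by norm_num) (by omega)
        have h5 : d ≤ 2 * n := by
          have : (d : ℝ) ≤ 2 * n := by linarith
          exact_mod_cast this
        have h6 : n ≤ 2 * d := by
          have : (n : ℝ) ≤ 2 * d := by linarith
          exact_mod_cast this
        have h7 : d ≤ 2 ^ k * n := h5.trans (by gcongr; simpa using h4)
        have h8 : n ≤ 2 ^ k * d := h6.trans (by gcongr; simpa using h4)
        exact ⟨by exact_mod_cast h7, by exact_mod_cast h8⟩
      refine ⟨⟨by simpa using hd0', ?_, ?_⟩, ?_, ?_⟩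
      · intro i
        fin_cases i
        · simpa using hpow a ha1 ha2
        · simpa using hpow b hb1 hb2
        · simpa using hpow c hc1 hc2
        · simpa using hpow d hd1 hd2
      · have e : rsG α (rsC ![(a : ℤ), b, c, d]) = ((a : ℝ) ^ α + (b : ℝ) ^ α) - ((c : ℝ) ^ α + (d : ℝ) ^ α) := by
          simp [rsG, rsC]; ring
        rw [e]
        refine hlt.le.trans ?_
        have h1 : (2 * N) ^ (α - 2) ≤ (d : ℝ) ^ (α - 2) := Real.rpow_le_rpow_of_nonpos hd0 hd2 (by linarith)
        have h2 : (2 * N) ^ (α - 2) = (2 * N) ^ α / (4 * N ^ 2) := by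
          rw [Real.rpow_sub (by linarith)]
          norm_num
          ring_nf
        have h3 : N ^ α ≤ (2 * N) ^ α := Real.rpow_le_rpow hN0.le (by linarith) hα0.le
        calc N ^ α / (4 * N ^ 2) ≤ (2 * N) ^ α / (4 * N ^ 2) := by gcongr
          _ ≤ (d : ℝ) ^ (α - 2) := by rw [← h2]; exact h1
          _ = _ := by simp
      · simp only [Matrix.cons_val]
        exact_mod_cast hdl1
      · simp only [Matrix.cons_val]
        exact_mod_cast hdl2
    · rintro ⟨⟨a, b⟩, c, d⟩ _ ⟨⟨a', b'⟩, c', d'⟩ _ h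
      have h0 := congrFun h 0
      have h1 := congrFun h 1
      have h2 := congrFun h 2
      have h3 := congrFun h 3
      simp at h0 h1 h2 h3
      simp [h0, h1, h2, h3]
  have h1 : (T.card : ℝ) ≤ ∑ j ∈ Finset.range (J + 1), rsa α (2 ^ k) j := by
    have := hcard.trans Finset.card_biUnion_le
    unfold rsa
    exact_mod_cast this
  have h2 : ∑ j ∈ Finset.range (J + 1), rsa α (2 ^ k) j ≤ B * (g * (R * 4) ^ J) := by
    calc _ ≤ ∑ j ∈ Finset.range (J + 1), B * (R * 4) ^ j := by
          apply Finset.sum_le_sum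
          intro j _
          rw [mul_pow, ← mul_assoc]; exact hcount j
      _ = B * ∑ j ∈ Finset.range (J + 1), (R * 4) ^ j := by rw [Finset.mul_sum]
      _ ≤ _ := mul_le_mul_of_nonneg_left (rs_geom _ h4R _) hB
  have h3 : (R * 4) ^ J ≤ (2 ^ ε * 4) * (N ^ ε * N ^ 2) := by
    have e1 : R ^ J = ((2 : ℝ) ^ J) ^ ε := by
      rw [hR, ← Real.rpow_natCast, ← Real.rpow_natCast, ← Real.rpow_mul (by norm_num), ← Real.rpow_mul (by norm_num), mul_comm]
    have e2 : (4 : ℝ) ^ J = (2 ^ J) ^ 2 := by rw [← pow_mul, mul_comm, pow_mul]; norm_num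
    rw [mul_pow, e1, e2]
    calc ((2 : ℝ) ^ J) ^ ε * (2 ^ J) ^ 2 ≤ (2 * N) ^ ε * (2 * N) ^ 2 := by gcongr
      _ = _ := by rw [Real.mul_rpow (by norm_num) hN0.le]; ring
  have hp : 0 ≤ N ^ ε * N ^ 2 := by positivity
  calc (T.card : ℝ) ≤ B * (g * (R * 4) ^ J) := h1.trans h2
    _ ≤ B * (g * ((2 ^ ε * 4) * (N ^ ε * N ^ 2))) := by gcongr
    _ ≤ _ := by linarith

/-- Lemma 5 (Robert–Sargos): for fixed `k ≥ 2`, the number of quadruples of integers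
`(n₁,n₂,n₃,n₄)` with `N < nᵢ ≤ 2N` and `|n₁^{1/k} + n₂^{1/k} - n₃^{1/k} - n₄^{1/k}| < δN^{1/k}`
is `≪_ε N^ε (N⁴δ + N²)`. -/
theorem spacing_four_kth_roots (k : ℕ) (hk : 2 ≤ k) :
    ∀ ε : ℝ, 0 < ε → ∃ C : ℝ, 0 < C ∧ ∀ N δ : ℝ, 0 < N → 0 < δ →
      (Nat.card {q : ℕ × ℕ × ℕ × ℕ |
          (N < (q.1 : ℝ) ∧ (q.1 : ℝ) ≤ 2 * N) ∧
          (N < (q.2.1 : ℝ) ∧ (q.2.1 : ℝ) ≤ 2 * N) ∧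
          (N < (q.2.2.1 : ℝ) ∧ (q.2.2.1 : ℝ) ≤ 2 * N) ∧
          (N < (q.2.2.2 : ℝ) ∧ (q.2.2.2 : ℝ) ≤ 2 * N) ∧
          |(q.1 : ℝ) ^ (1 / (k : ℝ)) + (q.2.1 : ℝ) ^ (1 / (k : ℝ)) -
              (q.2.2.1 : ℝ) ^ (1 / (k : ℝ)) - (q.2.2.2 : ℝ) ^ (1 / (k : ℝ))| <
            δ * N ^ (1 / (k : ℝ))} : ℝ) ≤
        C * N ^ ε * (N ^ 4 * δ + N ^ 2) := by
  classical
  intro ε hε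
  obtain ⟨C, hC, hsmall⟩ := rs_small k hk ε hε
  refine ⟨8 * C, by positivity, ?_⟩
  intro N δ hN hδ
  set α : ℝ := 1 / (k : ℝ) with hα
  set E := Finset.Ioc ⌊N⌋₊ ⌊2 * N⌋₊ with hE
  have hEm : ∀ n : ℕ, N < (n : ℝ) → (n : ℝ) ≤ 2 * N → n ∈ E := by
    intro n h1 h2
    rw [hE, Finset.mem_Ioc]
    exact ⟨(Nat.floor_lt hN.le).2 h1, (Nat.le_floor_iff (by linarith)).2 h2⟩
  let gg : ℕ × ℕ → ℝ := fun p => (p.1 : ℝ) ^ α + (p.2 : ℝ) ^ α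
  have hNα : 0 < N ^ α := by positivity
  set T := ((E ×ˢ E) ×ˢ (E ×ˢ E)).filter (fun r => |gg r.1 - gg r.2| < δ * N ^ α) with hT
  have hle : Nat.card {q : ℕ × ℕ × ℕ × ℕ |
          (N < (q.1 : ℝ) ∧ (q.1 : ℝ) ≤ 2 * N) ∧
          (N < (q.2.1 : ℝ) ∧ (q.2.1 : ℝ) ≤ 2 * N) ∧
          (N < (q.2.2.1 : ℝ) ∧ (q.2.2.1 : ℝ) ≤ 2 * N) ∧
          (N < (q.2.2.2 : ℝ) ∧ (q.2.2.2 : ℝ) ≤ 2 * N) ∧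
          |(q.1 : ℝ) ^ α + (q.2.1 : ℝ) ^ α -
              (q.2.2.1 : ℝ) ^ α - (q.2.2.2 : ℝ) ^ α| <
            δ * N ^ α} ≤ T.card := by
    rw [Nat.card_coe_set_eq, ← Set.ncard_coe_finset]
    apply Set.ncard_le_ncard_of_injOn (fun q : ℕ × ℕ × ℕ × ℕ => ((q.1, q.2.1), (q.2.2.1, q.2.2.2)))
    · rintro ⟨a, b, c, d⟩ ⟨ha, hb, hc, hd, h⟩
      simp only at ha hb hc hd h
      rw [Finset.mem_coe, hT, Finset.mem_filter]
      refine ⟨?_, ?_⟩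
      · simp only [Finset.mem_product]
        exact ⟨⟨hEm a ha.1 ha.2, hEm b hb.1 hb.2⟩, hEm c hc.1 hc.2, hEm d hd.1 hd.2⟩
      · simp only [gg]
        rw [← sub_sub]; exact h
    · rintro ⟨a, b, c, d⟩ _ ⟨a', b', c', d'⟩ _ h
      simp only [Prod.mk.injEq] at h ⊢
      tauto
  have hle' := Nat.cast_le (α := ℝ).2 hle
  refine hle'.trans ?_
  by_cases h1 : 1 ≤ 2 * N
  · have hb := rs_bins (E ×ˢ E) gg (N ^ α / (4 * N ^ 2)) (δ * N ^ α) (by positivity) (by positivity)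
    have hs := hsmall N h1
    have e : δ * N ^ α / (N ^ α / (4 * N ^ 2)) = 4 * N ^ 2 * δ := by field_simp
    rw [e] at hb
    refine hb.trans ?_
    calc (2 * (4 * N ^ 2 * δ) + 3) * _ ≤ (2 * (4 * N ^ 2 * δ) + 3) * (C * N ^ ε * N ^ 2) :=
          mul_le_mul_of_nonneg_left hs (by positivity)
      _ ≤ _ := by
        have : 0 ≤ C * N ^ ε * N ^ 2 := by positivity
        nlinarith
  · push Not at h1
    have hE0 : E = ∅ := by
      rw [hE]
      apply Finset.Ioc_eq_empty
      have : ⌊2 * N⌋₊ = 0 := Nat.floor_eq_zero.2 h1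
      omega
    have : T = ∅ := by rw [hT, hE0]; simp
    rw [this]
    simp only [Finset.card_empty, Nat.cast_zero]
    positivity
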